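/- arXiv:1605.03830 — 3 statements merged into one kernel-verified Lean document; each statement's English description precedes it below -/
import Mathlib

section
/- Let α > 0 and ξ < 0. For every n ≥ 1 the polynomial A_n has at least one real zero and every real zero of A_n is positive; moreover, denoting by μ_{1,n} the smallest real zero of A_n, every real polynomial p of degree at most n satisfies ∫_0^∞ p'(x)²·x^α·e^{-x} dx ≤ (1/μ_{1,n})·∫_0^∞ p(x)²·(x-ξ)·x^{α-1}·e^{-x} dx. -/
open Polynomial MeasureTheory

/-- The polynomials `A_n(λ)` of the Laguerre case (a):
`A_0 = 1`, `A_1(λ) = λ - α - 1 + ξ - ξ/(ξ-α)`, and for `n ≥ 2`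
`A_n(λ) = (λ - 2 + (ξ-α)/n)·A_{n-1}(λ) - (1 + α/(n-1))·A_{n-2}(λ)`. -/
noncomputable def Apoly (α ξ : ℝ) : ℕ → Polynomial ℝ
  | 0 => 1
  | 1 => Polynomial.X - Polynomial.C (α + 1 - ξ + ξ / (ξ - α))
  | n + 2 =>
      (Polynomial.X - Polynomial.C (2 - (ξ - α) / ((n : ℝ) + 2))) * Apoly α ξ (n + 1) -
        Polynomial.C (1 + α / ((n : ℝ) + 1)) * Apoly α ξ n

/-- The Laguerre polynomials with parameter `α - 1`, generated by the raising operator. -/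
noncomputable def laguerre (α : ℝ) : ℕ → ℝ[X]
  | 0 => 1
  | k + 1 => C ((k : ℝ) + 1)⁻¹ *
      (X * derivative (laguerre α k) + (C ((k : ℝ) + α) - X) * laguerre α k)

namespace laguerre

lemma raising (α : ℝ) (k : ℕ) :
    C ((k : ℝ) + 1) * laguerre α (k + 1) =
      X * derivative (laguerre α k) + (C ((k : ℝ) + α) - X) * laguerre α k := by
  have hk : ((k : ℝ) + 1) ≠ 0 := by positivity
  rw [laguerre, ← mul_assoc, ← C_mul, mul_inv_cancel₀ hk, C_1, one_mul]

lemma derivative_succ_of_ode (α : ℝ) (k : ℕ)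
    (h : X * derivative (derivative (laguerre α k)) +
      (C α - X) * derivative (laguerre α k) = -(C (k : ℝ) * laguerre α k)) :
    derivative (laguerre α (k + 1)) = derivative (laguerre α k) - laguerre α k := by
  have hk : C ((k : ℝ) + 1) ≠ 0 := by
    rw [Ne, C_eq_zero]; positivity
  have h1 := congrArg derivative (raising α k)
  simp only [derivative_mul, derivative_add, derivative_sub, derivative_C, derivative_X] at h1
  apply mul_left_cancel₀ hk
  simp only [C_add, C_1] at *
  linear_combination h1 + h

lemma ode (α : ℝ) (k : ℕ) :
    X * derivative (derivative (laguerre α k)) + (C α - X) * derivative (laguerre α k) =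
      -(C (k : ℝ) * laguerre α k) := by
  induction k with
  | zero => simp [laguerre]
  | succ k ih =>
    have h1 := raising α k
    have h2 := derivative_succ_of_ode α k ih
    rw [h2, derivative_sub]
    push_cast
    simp only [C_add, C_1] at *
    linear_combination ih + h1

lemma derivative_succ (α : ℝ) (k : ℕ) :
    derivative (laguerre α (k + 1)) = derivative (laguerre α k) - laguerre α k :=
  derivative_succ_of_ode α k (ode α k)

lemma X_mul_derivative_succ (α : ℝ) (k : ℕ) :
    X * derivative (laguerre α (k + 1)) =
      C ((k : ℝ) + 1) * laguerre α (k + 1) - C ((k : ℝ) + α) * laguerre α k := by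
  rw [derivative_succ, raising]
  ring

lemma X_mul_succ (α : ℝ) (k : ℕ) :
    X * laguerre α (k + 1) = C (2 * (k : ℝ) + 2 + α) * laguerre α (k + 1) -
      C ((k : ℝ) + α) * laguerre α k - C ((k : ℝ) + 2) * laguerre α (k + 2) := by
  have h1 := X_mul_derivative_succ α k
  have h2 := raising α (k + 1)
  push_cast at h2
  have e : (C (2 : ℝ) : ℝ[X]) = 1 + 1 := by rw [← C_1, ← C_add]; norm_num
  simp only [C_add, C_mul, C_1, e] at h1 h2 ⊢
  linear_combination h1 + h2

lemma natDegree_le (α : ℝ) (k : ℕ) : (laguerre α k).natDegree ≤ k := by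
  induction k with
  | zero => simp [laguerre]
  | succ k ih =>
    rw [laguerre]
    refine (natDegree_C_mul_le _ _).trans (natDegree_add_le_of_degree_le ?_ ?_)
    · refine natDegree_mul_le.trans ?_
      have := natDegree_derivative_le (laguerre α k)
      have := natDegree_X_le (R := ℝ)
      omega
    · refine natDegree_mul_le.trans ?_
      have : (C ((k : ℝ) + α) - X).natDegree ≤ 1 :=
        (natDegree_sub_le _ _).trans (by simp)
      omega

lemma coeff_self_ne_zero (α : ℝ) (k : ℕ) : (laguerre α k).coeff k ≠ 0 := by
  induction k with
  | zero => simp [laguerre]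
  | succ k ih =>
    intro h
    have h1 := congrArg (fun p => coeff p k) (derivative_succ α k)
    have h2 : (laguerre α k).coeff (k + 1) = 0 :=
      coeff_eq_zero_of_natDegree_lt (Nat.lt_succ_of_le (natDegree_le α k))
    simp only [coeff_derivative, coeff_sub, h, h2] at h1
    apply ih
    linarith

lemma exists_eq_C_mul_add (α : ℝ) (n : ℕ) (p : ℝ[X]) (hp : p.natDegree ≤ n + 1) :
    ∃ (a : ℝ) (q : ℝ[X]), q.natDegree ≤ n ∧ p = C a * laguerre α (n + 1) + q := by
  have hc := coeff_self_ne_zero α (n + 1)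
  refine ⟨p.coeff (n + 1) / (laguerre α (n + 1)).coeff (n + 1), _, ?_,
    (add_sub_cancel _ _).symm⟩
  rw [natDegree_le_iff_coeff_eq_zero]
  intro N hN
  rw [coeff_sub, coeff_C_mul]
  rcases (Nat.succ_le_of_lt hN).eq_or_lt with h | h
  · subst h
    rw [Nat.succ_eq_add_one, div_mul_cancel₀ _ hc, sub_self]
  · rw [coeff_eq_zero_of_natDegree_lt (hp.trans_lt h),
      coeff_eq_zero_of_natDegree_lt ((natDegree_le α _).trans_lt h), mul_zero, sub_zero]

section Functional

variable {α : ℝ} {Λ : ℝ[X] →ₗ[ℝ] ℝ}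

lemma map_C_mul (Λ : ℝ[X] →ₗ[ℝ] ℝ) (a : ℝ) (p : ℝ[X]) : Λ (C a * p) = a * Λ p := by
  rw [← smul_eq_C_mul, map_smul, smul_eq_mul]

lemma map_derivative_mul (hΛ : ∀ q, Λ (X * derivative q + (C α - X) * q) = 0) (k : ℕ)
    (q : ℝ[X]) :
    Λ (X * derivative q * derivative (laguerre α k)) = k * Λ (q * laguerre α k) := by
  have h := hΛ (derivative (laguerre α k) * q)
  rw [derivative_mul, show X * (derivative (derivative (laguerre α k)) * q +
      derivative (laguerre α k) * derivative q) + (C α - X) * (derivative (laguerre α k) * q) =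
      X * derivative q * derivative (laguerre α k) - C (k : ℝ) * (q * laguerre α k) by
    linear_combination q * ode α k, map_sub, map_C_mul] at h
  linarith

lemma orthogonal (hΛ : ∀ q, Λ (X * derivative q + (C α - X) * q) = 0) {j k : ℕ} (h : j ≠ k) :
    Λ (laguerre α j * laguerre α k) = 0 := by
  have h1 := map_derivative_mul hΛ k (laguerre α j)
  have h2 := map_derivative_mul hΛ j (laguerre α k)
  rw [show X * derivative (laguerre α k) * derivative (laguerre α j) =
    X * derivative (laguerre α j) * derivative (laguerre α k) by ring, h1,
    mul_comm (laguerre α k)] at h2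
  have h3 : ((k : ℝ) - j) * Λ (laguerre α j * laguerre α k) = 0 := by linarith
  refine (mul_eq_zero.mp h3).resolve_left (sub_ne_zero.mpr ?_)
  exact_mod_cast h.symm

lemma orthogonal_of_natDegree_le (hΛ : ∀ q, Λ (X * derivative q + (C α - X) * q) = 0) (n : ℕ) :
    ∀ q : ℝ[X], q.natDegree ≤ n → ∀ m, n < m → Λ (q * laguerre α m) = 0 := by
  induction n with
  | zero =>
    intro q hq m hm
    have h := orthogonal hΛ hm.ne
    rw [laguerre] at h
    rw [eq_C_of_natDegree_le_zero hq, map_C_mul, ← one_mul (laguerre α m), h, mul_zero]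
  | succ n ih =>
    intro p hp m hm
    obtain ⟨a, q, hq, rfl⟩ := exists_eq_C_mul_add α n p hp
    rw [add_mul, map_add, mul_assoc, map_C_mul, orthogonal hΛ hm.ne, ih q hq m (by omega)]
    simp

lemma sq_norm_succ (hΛ : ∀ q, Λ (X * derivative q + (C α - X) * q) = 0) (k : ℕ) :
    (k + 1) * Λ (laguerre α (k + 1) * laguerre α (k + 1)) =
      (k + α) * Λ (laguerre α k * laguerre α k) := by
  have h := hΛ (laguerre α k * laguerre α (k + 1))
  have h1 := raising α k
  have h2 := X_mul_derivative_succ α k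
  rw [derivative_mul, show X * (derivative (laguerre α k) * laguerre α (k + 1) +
      laguerre α k * derivative (laguerre α (k + 1))) +
      (C α - X) * (laguerre α k * laguerre α (k + 1)) =
      C ((k : ℝ) + 1) * (laguerre α (k + 1) * laguerre α (k + 1))
      + C 1 * (laguerre α k * laguerre α (k + 1))
      - C ((k : ℝ) + α) * (laguerre α k * laguerre α k) by
    simp only [C_add, C_1] at *
    linear_combination (-laguerre α (k + 1)) * h1 + laguerre α k * h2] at h
  rw [map_sub, map_add, map_C_mul, map_C_mul, map_C_mul,
    orthogonal hΛ (Nat.lt_succ_self k).ne] at h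
  linarith

lemma sq_norm_pos (hα : 0 < α) (hΛ : ∀ q, Λ (X * derivative q + (C α - X) * q) = 0)
    (h1 : 0 < Λ 1) (k : ℕ) : 0 < Λ (laguerre α k * laguerre α k) := by
  induction k with
  | zero => simpa [laguerre] using h1
  | succ k ih =>
    have h := sq_norm_succ hΛ k
    have : 0 < (k + α) * Λ (laguerre α k * laguerre α k) := by positivity
    rw [← h] at this
    exact pos_of_mul_pos_right this (by positivity)

/-- The quadratic form of the Laguerre pencil is bounded below by its last pivot. -/
lemma pivot_le_form (hα : 0 < α) (hΛ : ∀ q, Λ (X * derivative q + (C α - X) * q) = 0)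
    (h1 : 0 < Λ 1) {ξ l : ℝ} {s : ℕ → ℝ} (s_zero : s 0 = α - ξ)
    (s_succ : ∀ k, s (k + 1) =
      2 * (k + 1) + (α - ξ) - l * (k + 1) - (k + 1) * (k + α) / s k)
    (n : ℕ) (hs : ∀ k < n, 0 < s k) (p : ℝ[X]) (hp : p.natDegree ≤ n) :
    s n * Λ (p * laguerre α n) ^ 2 / Λ (laguerre α n * laguerre α n) ≤
      Λ ((X - C ξ) * (p * p)) - l * Λ (X * derivative p * derivative p) := by
  induction n generalizing p with
  | zero =>
    obtain ⟨c, rfl⟩ : ∃ c, p = C c := ⟨_, eq_C_of_natDegree_le_zero hp⟩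
    have h2 := hΛ 1
    have h3 : X * derivative 1 + (C α - X) * 1 = C α * (1 : ℝ[X]) - X := by simp
    rw [h3, map_sub, map_C_mul] at h2
    have e1 : (X - C ξ) * (C c * C c) = C (c * c) * X - C (c * c * ξ) * 1 := by
      simp only [C_mul]; ring
    have e2 (d : ℝ) : Λ (C d) = d * Λ 1 := by rw [← map_C_mul, mul_one]
    rw [e1, map_sub, map_C_mul, map_C_mul, s_zero, show Λ X = α * Λ 1 by linarith]
    simp only [laguerre, derivative_C, mul_zero, map_zero, sub_zero, mul_one, e2]
    apply le_of_eq
    field_simp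
  | succ n ih =>
    obtain ⟨a, q, hq, rfl⟩ := exists_eq_C_mul_add α n p hp
    have ihq := ih (fun k hk => hs k (by omega)) q hq
    have hsn := hs n (Nat.lt_succ_self n)
    have hg := sq_norm_pos hα hΛ h1 n
    have hg' := sq_norm_pos hα hΛ h1 (n + 1)
    have hgg := sq_norm_succ hΛ n
    have o1 := orthogonal_of_natDegree_le hΛ n q hq (n + 1) (by omega)
    have o2 := orthogonal_of_natDegree_le hΛ n q hq (n + 2) (by omega)
    have o3 := orthogonal hΛ (α := α) (j := n + 1) (k := n) (by omega)
    have o4 := orthogonal hΛ (α := α) (j := n + 1) (k := n + 2) (by omega)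
    have d1 := map_derivative_mul hΛ (n + 1) q
    have d2 := map_derivative_mul hΛ (n + 1) (laguerre α (n + 1))
    have x := X_mul_succ α n
    set u := laguerre α (n + 1) with hu
    have e1 : Λ ((C a * u + q) * u) = a * Λ (u * u) := by
      rw [add_mul, mul_assoc, map_add, map_C_mul, o1, add_zero]
    have x1 : Λ (X * (q * u)) = -((n + α) * Λ (q * laguerre α n)) := by
      rw [show X * (q * u) = C (2 * (n : ℝ) + 2 + α) * (q * u) -
        C ((n : ℝ) + α) * (q * laguerre α n) - C ((n : ℝ) + 2) * (q * laguerre α (n + 2)) by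
        linear_combination q * x]
      rw [map_sub, map_sub, map_C_mul, map_C_mul, map_C_mul, o1, o2]
      ring
    have x2 : Λ (X * (u * u)) = (2 * n + 2 + α) * Λ (u * u) := by
      rw [show X * (u * u) = C (2 * (n : ℝ) + 2 + α) * (u * u) -
        C ((n : ℝ) + α) * (u * laguerre α n) - C ((n : ℝ) + 2) * (u * laguerre α (n + 2)) by
        linear_combination u * x]
      rw [map_sub, map_sub, map_C_mul, map_C_mul, map_C_mul, o3, o4]
      ring
    have e2 : Λ ((X - C ξ) * ((C a * u + q) * (C a * u + q))) =
        Λ ((X - C ξ) * (q * q)) - 2 * a * ((n + α) * Λ (q * laguerre α n))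
          + a ^ 2 * (2 * n + 2 + α - ξ) * Λ (u * u) := by
      rw [show (X - C ξ) * ((C a * u + q) * (C a * u + q)) =
        (X - C ξ) * (q * q) + C (2 * a) * (X * (q * u)) - C (2 * a * ξ) * (q * u)
          + C (a ^ 2) * (X * (u * u)) - C (a ^ 2 * ξ) * (u * u) by
        have e : (C (2 : ℝ) : ℝ[X]) = 1 + 1 := by rw [← C_1, ← C_add]; norm_num
        simp only [C_mul, C_pow, e]; ring]
      simp only [map_sub, map_add, map_C_mul, o1, x1, x2]
      ring
    have e3 : Λ (X * derivative (C a * u + q) * derivative (C a * u + q)) =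
        Λ (X * derivative q * derivative q) + a ^ 2 * (n + 1) * Λ (u * u) := by
      rw [show X * derivative (C a * u + q) * derivative (C a * u + q) =
        X * derivative q * derivative q + C (2 * a) * (X * derivative q * derivative u)
          + C (a ^ 2) * (X * derivative u * derivative u) by
        have e : (C (2 : ℝ) : ℝ[X]) = 1 + 1 := by rw [← C_1, ← C_add]; norm_num
        simp only [C_mul, C_pow, e, derivative_add, derivative_mul, derivative_C]; ring]
      simp only [map_add, map_C_mul, d1, d2, o1]
      push_cast
      ring
    rw [e1, e2, e3, s_succ]
    set G := Λ (u * u)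
    set g := Λ (laguerre α n * laguerre α n)
    set b := Λ (q * laguerre α n)
    have key : s n * b ^ 2 / g - 2 * a * ((n + α) * b) + a ^ 2 * ((n + α) * g) * (n + α) / s n =
        s n / g * (b - a * (n + α) * g / s n) ^ 2 := by
      field_simp
      ring
    have hpos : 0 ≤ s n / g * (b - a * (n + α) * g / s n) ^ 2 := by positivity
    have e4 : (2 * ((n : ℝ) + 1) + (α - ξ) - l * (n + 1) - (n + 1) * (n + α) / s n) *
        (a * G) ^ 2 / G = a ^ 2 * (2 * n + 2 + α - ξ) * G - l * (a ^ 2 * (n + 1) * G)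
          - a ^ 2 * ((n + 1) * G) * (n + α) / s n := by
      field_simp
      ring
    rw [e4, hgg]
    linarith

end Functional

end laguerre

lemma integrableOn_eval_mul_gamma_weight {α : ℝ} (hα : 0 < α) (p : ℝ[X]) :
    IntegrableOn (fun x => p.eval x * (x ^ (α - 1) * Real.exp (-x))) (Set.Ioi 0) := by
  induction p using Polynomial.induction_on' with
  | add p q hp hq =>
    simp only [eval_add, add_mul]
    exact hp.add hq
  | monomial k a =>
    have h := (Real.GammaIntegral_convergent (s := α + k) (by positivity)).const_mul a
    refine IntegrableOn.congr_fun h (fun x hx => ?_) measurableSet_Ioi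
    simp only [eval_monomial]
    rw [show α + k - 1 = (α - 1) + k by ring, Real.rpow_add_natCast (ne_of_gt hx)]
    ring

/-- Integration of polynomials against `x ^ (α - 1) * exp (-x)` on `(0, ∞)`. -/
noncomputable def gammaFunctional {α : ℝ} (hα : 0 < α) : ℝ[X] →ₗ[ℝ] ℝ where
  toFun p := ∫ x in Set.Ioi (0 : ℝ), p.eval x * (x ^ (α - 1) * Real.exp (-x))
  map_add' p q := by
    simp only [eval_add, add_mul]
    exact integral_add (integrableOn_eval_mul_gamma_weight hα p)
      (integrableOn_eval_mul_gamma_weight hα q)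
  map_smul' a p := by
    simp only [eval_smul, smul_eq_mul, mul_assoc, RingHom.id_apply]
    exact integral_const_mul _ _

lemma gammaFunctional_monomial {α : ℝ} (hα : 0 < α) (k : ℕ) (a : ℝ) :
    gammaFunctional hα (monomial k a) = a * Real.Gamma (α + k) := by
  rw [Real.Gamma_eq_integral (by positivity), ← integral_const_mul]
  refine setIntegral_congr_fun measurableSet_Ioi (fun x hx => ?_)
  simp only [eval_monomial]
  rw [show α + k - 1 = (α - 1) + k by ring, Real.rpow_add_natCast (ne_of_gt hx)]
  ring

lemma gammaFunctional_one_pos {α : ℝ} (hα : 0 < α) : 0 < gammaFunctional hα 1 := by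
  have h := gammaFunctional_monomial hα 0 1
  rw [monomial_zero_left, C_1] at h
  rw [h]
  simpa using Real.Gamma_pos_of_pos hα

lemma gammaFunctional_pearson {α : ℝ} (hα : 0 < α) (q : ℝ[X]) :
    gammaFunctional hα (X * derivative q + (C α - X) * q) = 0 := by
  induction q using Polynomial.induction_on' with
  | add p q hp hq =>
    rw [derivative_add, show X * (derivative p + derivative q) + (C α - X) * (p + q) =
      (X * derivative p + (C α - X) * p) + (X * derivative q + (C α - X) * q) by ring,
      map_add, hp, hq, add_zero]
  | monomial k a =>
    have h : X * derivative (monomial k a) + (C α - X) * monomial k a =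
        monomial k ((k + α) * a) - monomial (k + 1) a := by
      simp only [← C_mul_X_pow_eq_monomial, derivative_C_mul_X_pow, C_mul, C_add]
      cases k with
      | zero => simp; ring
      | succ k => simp; ring
    rw [h, map_sub, gammaFunctional_monomial, gammaFunctional_monomial]
    push_cast
    rw [← add_assoc, Real.Gamma_add_one (by positivity)]
    ring

/-- The values of `(-1)^n A_n`. -/
noncomputable def signedApoly (α ξ : ℝ) (n : ℕ) (x : ℝ) : ℝ := (-1) ^ n * (Apoly α ξ n).eval x

namespace signedApoly

variable {α ξ : ℝ}

lemma zero (x : ℝ) : signedApoly α ξ 0 x = 1 := by simp [signedApoly, Apoly]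

lemma one (h : α - ξ ≠ 0) (x : ℝ) :
    signedApoly α ξ 1 x = 2 + (α - ξ) - x - α / (α - ξ) := by
  have h' : ξ - α ≠ 0 := fun e => h (by linarith)
  simp only [signedApoly, Apoly, eval_sub, eval_X, eval_C]
  field_simp
  ring

lemma add_two (n : ℕ) (x : ℝ) :
    signedApoly α ξ (n + 2) x = (2 + (α - ξ) / (n + 2) - x) * signedApoly α ξ (n + 1) x -
      (1 + α / (n + 1)) * signedApoly α ξ n x := by
  simp only [signedApoly, Apoly, eval_sub, eval_mul, eval_X, eval_C]
  ring

lemma continuous (n : ℕ) : Continuous (signedApoly α ξ n) :=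
  continuous_const.mul (Apoly α ξ n).continuous

lemma eq_zero_iff (n : ℕ) (x : ℝ) : signedApoly α ξ n x = 0 ↔ (Apoly α ξ n).eval x = 0 := by
  simp [signedApoly]

lemma growth_of_nonpos (hα : 0 < α) (hξ : ξ < 0) {x : ℝ} (hx : x ≤ 0) (n : ℕ) :
    0 < signedApoly α ξ n x ∧
      (1 + α / (n + 1)) * signedApoly α ξ n x < signedApoly α ξ (n + 1) x := by
  induction n with
  | zero =>
    rw [zero, one (by linarith)]
    have : α / (α - ξ) < 1 := by rw [div_lt_one (by linarith)]; linarith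
    norm_num
    linarith
  | succ n ih =>
    obtain ⟨h1, h2⟩ := ih
    have h3 : 0 < signedApoly α ξ (n + 1) x := lt_trans (by positivity) h2
    refine ⟨h3, ?_⟩
    rw [add_two]
    push_cast
    have h4 : α / ((n : ℝ) + 2) < (α - ξ) / (n + 2) := by gcongr; linarith
    have h5 : (1 + α / ((n : ℝ) + 1 + 1)) * signedApoly α ξ (n + 1) x <
        (1 + (α - ξ) / (n + 2) - x) * signedApoly α ξ (n + 1) x := by
      gcongr
      rw [show (n : ℝ) + 1 + 1 = n + 2 by ring]
      linarith
    linarith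

lemma exists_first_zero (hα : 0 < α) (hξ : ξ < 0) (n : ℕ) :
    ∃ m : ℝ, 0 < m ∧ signedApoly α ξ (n + 1) m = 0 ∧
      (∀ x < m, 0 < signedApoly α ξ (n + 1) x) ∧
      ∀ k ≤ n, ∀ x ≤ m, 0 < signedApoly α ξ k x := by
  induction n with
  | zero =>
    have : α / (α - ξ) < 1 := by rw [div_lt_one (by linarith)]; linarith
    refine ⟨2 + (α - ξ) - α / (α - ξ), by linarith, ?_, fun x hx => ?_, fun k hk x _ => ?_⟩
    · rw [one (by linarith)]; ring
    · rw [one (by linarith)]; linarith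
    · rw [Nat.le_zero.mp hk, zero]; exact one_pos
  | succ n ih =>
    obtain ⟨m, hm, hm0, hlt, hk⟩ := ih
    have hneg : signedApoly α ξ (n + 2) m < 0 := by
      rw [add_two, hm0]
      have := hk n le_rfl m le_rfl
      have : 0 < (1 + α / (n + 1)) * signedApoly α ξ n m := by positivity
      linarith
    have h0 : ∀ x ≤ 0, 0 < signedApoly α ξ (n + 2) x :=
      fun x hx => (growth_of_nonpos hα hξ hx (n + 2)).1
    have ivt : ∀ y, 0 ≤ y → signedApoly α ξ (n + 2) y ≤ 0 →
        ∃ z ∈ Set.Icc 0 y, signedApoly α ξ (n + 2) z = 0 := fun y hy hy' =>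
      intermediate_value_Icc' hy (continuous (n + 2)).continuousOn ⟨hy', (h0 0 le_rfl).le⟩
    obtain ⟨z, hz, hz0⟩ := ivt m hm.le hneg.le
    have hcomp : IsCompact (Set.Icc 0 m ∩ signedApoly α ξ (n + 2) ⁻¹' {0}) :=
      isCompact_Icc.inter_right (isClosed_singleton.preimage (continuous (n + 2)))
    obtain ⟨r, ⟨hr, hr0⟩, hmin⟩ := hcomp.exists_isLeast ⟨z, hz, hz0⟩
    have hr0 : signedApoly α ξ (n + 2) r = 0 := hr0
    have hrpos : 0 < r := by
      by_contra! h
      exact (h0 r h).ne' hr0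
    have hrm : r < m := by
      refine lt_of_le_of_ne hr.2 ?_
      rintro rfl
      exact hneg.ne hr0
    refine ⟨r, hrpos, hr0, fun x hx => ?_, fun k hk' x hx => ?_⟩
    · by_contra! h
      have hx0 : 0 ≤ x := by
        by_contra! h'
        exact (h0 x h'.le).not_ge h
      obtain ⟨y, hy, hy0⟩ := ivt x hx0 h
      have := hmin ⟨⟨hy.1, by linarith [hy.2]⟩, hy0⟩
      linarith [hy.2]
    · rcases hk'.eq_or_lt with rfl | h
      · exact hlt x (hx.trans_lt hrm)
      · exact hk k (by omega) x (by linarith)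

end signedApoly

/-- The pivots of the Laguerre pencil. -/
noncomputable def pencilPivot (α ξ l : ℝ) : ℕ → ℝ
  | 0 => α - ξ
  | k + 1 => 2 * (k + 1) + (α - ξ) - l * (k + 1) - (k + 1) * (k + α) / pencilPivot α ξ l k

lemma pencilPivot_succ_mul {α ξ l : ℝ} (hα : 0 < α) (hξ : ξ < 0) (n : ℕ)
    (h : ∀ k ≤ n, 0 < signedApoly α ξ k l) :
    pencilPivot α ξ l (n + 1) * signedApoly α ξ n l = (n + 1) * signedApoly α ξ (n + 1) l := by
  induction n with
  | zero =>
    rw [signedApoly.zero, signedApoly.one (by linarith)]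
    simp [pencilPivot]
  | succ n ih =>
    have h1 := h n (by omega)
    have h2 := h (n + 1) le_rfl
    have h3 := ih (fun k hk => h k (by omega))
    have h4 : pencilPivot α ξ l (n + 1) =
        (n + 1) * signedApoly α ξ (n + 1) l / signedApoly α ξ n l := by
      rw [eq_div_iff h1.ne', h3]
    rw [pencilPivot, h4, signedApoly.add_two]
    push_cast
    field_simp
    ring

theorem stmt2 (α ξ : ℝ) (hα : 0 < α) (hξ : ξ < 0) (n : ℕ) (hn : 1 ≤ n) :
    (∃ x : ℝ, (Apoly α ξ n).eval x = 0) ∧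
    (∀ x : ℝ, (Apoly α ξ n).eval x = 0 → 0 < x) ∧
    ∀ μ : ℝ, IsLeast {x : ℝ | (Apoly α ξ n).eval x = 0} μ →
      ∀ p : Polynomial ℝ, p.degree ≤ n →
        (∫ x in Set.Ioi (0 : ℝ),
            ((Polynomial.derivative p).eval x) ^ 2 * x ^ α * Real.exp (-x)) ≤
          (1 / μ) * ∫ x in Set.Ioi (0 : ℝ),
            (p.eval x) ^ 2 * (x - ξ) * x ^ (α - 1) * Real.exp (-x) := by
  obtain ⟨n, rfl⟩ : ∃ k, n = k + 1 := ⟨n - 1, by omega⟩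
  obtain ⟨m, hm, hm0, hlt, hk⟩ := signedApoly.exists_first_zero hα hξ n
  have hm0' := (signedApoly.eq_zero_iff _ _).mp hm0
  have hle : ∀ x, (Apoly α ξ (n + 1)).eval x = 0 → m ≤ x := by
    intro x hx
    by_contra! h
    exact (hlt x h).ne' ((signedApoly.eq_zero_iff _ _).mpr hx)
  refine ⟨⟨m, hm0'⟩, fun x hx => hm.trans_le (hle x hx), fun μ hμ p hp => ?_⟩
  obtain rfl : m = μ := le_antisymm (hle μ hμ.1) (hμ.2 hm0')
  have hpos : ∀ k < n + 1, 0 < pencilPivot α ξ m k := by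
    intro k hkn
    cases k with
    | zero => rw [pencilPivot]; linarith
    | succ k =>
      have h1 := pencilPivot_succ_mul hα hξ k (fun j hj => hk j (by omega) m le_rfl)
      have h2 := hk k (by omega) m le_rfl
      have h3 := hk (k + 1) (by omega) m le_rfl
      have h4 : 0 < pencilPivot α ξ m (k + 1) * signedApoly α ξ k m := by
        rw [h1]; positivity
      exact pos_of_mul_pos_left h4 h2.le
  have hlast : pencilPivot α ξ m (n + 1) = 0 := by
    have h1 := pencilPivot_succ_mul hα hξ n (fun j hj => hk j hj m le_rfl)
    rw [hm0, mul_zero] at h1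
    exact (mul_eq_zero.mp h1).resolve_right (hk n le_rfl m le_rfl).ne'
  have key := laguerre.pivot_le_form hα (gammaFunctional_pearson hα)
    (gammaFunctional_one_pos hα) (s := pencilPivot α ξ m) (by rw [pencilPivot])
    (fun k => by rw [pencilPivot]) (n + 1) hpos p (natDegree_le_of_degree_le hp)
  rw [hlast, zero_mul, zero_div] at key
  have e1 : (∫ x in Set.Ioi (0 : ℝ),
      ((derivative p).eval x) ^ 2 * x ^ α * Real.exp (-x)) =
      gammaFunctional hα (X * derivative p * derivative p) := by
    refine setIntegral_congr_fun measurableSet_Ioi (fun x hx => ?_)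
    have hx' : x ^ α = x ^ (α - 1) * x := by
      rw [← Real.rpow_add_one (ne_of_gt hx), sub_add_cancel]
    simp only [eval_mul, eval_X, hx']
    ring
  have e2 : (∫ x in Set.Ioi (0 : ℝ),
      (p.eval x) ^ 2 * (x - ξ) * x ^ (α - 1) * Real.exp (-x)) =
      gammaFunctional hα ((X - C ξ) * (p * p)) := by
    refine setIntegral_congr_fun measurableSet_Ioi (fun x _ => ?_)
    simp only [eval_mul, eval_sub, eval_X, eval_C]
    ring
  rw [e1, e2, one_div, inv_mul_eq_div, le_div_iff₀ hm]
  linarith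
end

section
/- Let α > 0, β > 0, and ξ ∈ ℝ with |ξ| > 1; set ε = 1 if ξ < -1 and ε = -1 if ξ > 1. For every n ≥ 1 the polynomial A_n has at least one real zero and every real zero of A_n is positive; moreover, denoting by μ_{1,n} the smallest real zero of A_n, every real polynomial p of degree at most n satisfies ∫_{-1}^1 p'(x)²·(1-x)^α(1+x)^β dx ≤ (1/μ_{1,n})·∫_{-1}^1 p(x)²·ε(x-ξ)·(1-x)^{α-1}(1+x)^{β-1} dx. -/
open Polynomial MeasureTheory

/-- The coefficient `B_n` of the Jacobi case (a). -/
noncomputable def BcoJ (α β ξ ε : ℝ) (n : ℕ) : ℝ :=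
  ε / ((n : ℝ) * ((n : ℝ) + α + β - 1)) *
    (ξ - (β - α) * (α + β - 2) /
      ((2 * (n : ℝ) + α + β - 2) * (2 * (n : ℝ) + α + β)))

/-- The coefficient `C_n` of the Jacobi case (a). -/
noncomputable def CcoJ (α β : ℝ) (n : ℕ) : ℝ :=
  4 * ((n : ℝ) + α - 1) * ((n : ℝ) + β - 1) /
    (((n : ℝ) - 1) * ((n : ℝ) + α + β - 1) * (2 * (n : ℝ) + α + β - 1) *
      (2 * (n : ℝ) + α + β - 2) ^ 2 * (2 * (n : ℝ) + α + β - 3))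

/-- The polynomials `A_n(λ)` of the Jacobi case (a). -/
noncomputable def ApolyJ (α β ξ ε : ℝ) : ℕ → Polynomial ℝ
  | 0 => 1
  | 1 => Polynomial.X +
      Polynomial.C (ε * ((1 + α + β) * (2 + α + β) * ξ ^ 2 +
          2 * (α - β) * (1 + α + β) * ξ + (α - β) ^ 2 - (2 + α + β)) /
        ((1 + α + β) * (2 + α + β) * (ξ * (α + β) - β + α)))
  | n + 2 =>
      (Polynomial.X + Polynomial.C (BcoJ α β ξ ε (n + 2))) * ApolyJ α β ξ ε (n + 1) -
        Polynomial.C (CcoJ α β (n + 2)) * ApolyJ α β ξ ε n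

theorem intervalIntegrable_jacobiWeight {α β : ℝ} (hα : 0 < α) (hβ : 0 < β) :
    IntervalIntegrable (fun x : ℝ => (1 - x) ^ (α - 1) * (1 + x) ^ (β - 1)) volume (-1) 1 := by
  have key : ∀ {a b : ℝ}, 0 < b → IntervalIntegrable
      (fun x : ℝ => (1 + x) ^ (b - 1) * (1 - x) ^ (a - 1)) volume (-1) 0 := by
    intro a b hb
    refine IntervalIntegrable.mul_continuousOn ?_ ?_
    · have h := (intervalIntegral.intervalIntegrable_rpow' (a := 0) (b := 1) (r := b - 1)
        (by linarith)).comp_add_left 1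
      simpa using h
    · refine ContinuousOn.rpow_const (by fun_prop) fun x hx => Or.inl ?_
      rw [Set.uIcc_of_le (by norm_num)] at hx
      linarith [hx.2]
  refine IntervalIntegrable.trans (b := 0) ?_ ?_
  · simpa only [mul_comm] using key (a := α) hβ
  · have h := (IntervalIntegrable.iff_comp_neg).1 (key (a := β) hα)
    simpa [sub_eq_add_neg] using h.symm

theorem integrableOn_eval_mul_jacobiWeight {α β : ℝ} (hα : 0 < α) (hβ : 0 < β) (p : ℝ[X]) :
    IntegrableOn (fun x : ℝ => p.eval x * ((1 - x) ^ (α - 1) * (1 + x) ^ (β - 1)))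
      (Set.Ioo (-1) 1) := by
  have h := (intervalIntegrable_jacobiWeight hα hβ).continuousOn_mul
    (g := fun x => p.eval x) p.continuous.continuousOn
  rw [intervalIntegrable_iff_integrableOn_Ioo_of_le (by norm_num)] at h
  exact h

/-- Integration of a polynomial against `(1 - x) ^ (α - 1) * (1 + x) ^ (β - 1)` on `(-1, 1)`. -/
theorem exists_jacobiFunctional {α β : ℝ} (hα : 0 < α) (hβ : 0 < β) :
    ∃ L : ℝ[X] →ₗ[ℝ] ℝ, ∀ p, L p =
      ∫ x in Set.Ioo (-1 : ℝ) 1, p.eval x * ((1 - x) ^ (α - 1) * (1 + x) ^ (β - 1)) := by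
  refine ⟨⟨⟨fun p => ∫ x in Set.Ioo (-1 : ℝ) 1,
    p.eval x * ((1 - x) ^ (α - 1) * (1 + x) ^ (β - 1)), fun p q => ?_⟩, fun c p => ?_⟩,
    fun p => rfl⟩
  · rw [← integral_add (integrableOn_eval_mul_jacobiWeight hα hβ p)
      (integrableOn_eval_mul_jacobiWeight hα hβ q)]
    simp only [eval_add, add_mul]
  · simp only [eval_smul, smul_eq_mul, mul_assoc, RingHom.id_apply, integral_const_mul]

theorem jacobiWeight_mul_one_sub_mul_one_add {α β x : ℝ} (hx : x ∈ Set.Ioo (-1 : ℝ) 1) :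
    (1 - x) ^ α * (1 + x) ^ β = (1 - x ^ 2) * ((1 - x) ^ (α - 1) * (1 + x) ^ (β - 1)) := by
  have h1 : (1 - x) ≠ 0 := by linarith [hx.2]
  have h2 : (1 + x) ≠ 0 := by linarith [hx.1]
  rw [Real.rpow_sub_one h1, Real.rpow_sub_one h2]
  field_simp
  ring

/-- The Pearson equation of the Jacobi weight, in integrated form. -/
theorem integral_pearson_jacobiWeight {α β : ℝ} (hα : 0 < α) (hβ : 0 < β) (p : ℝ[X]) :
    ∫ x in Set.Ioo (-1 : ℝ) 1,
      ((1 - X ^ 2) * derivative p + (C (β - α) - C (α + β) * X) * p).eval x *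
        ((1 - x) ^ (α - 1) * (1 + x) ^ (β - 1)) = 0 := by
  rw [← integral_Ioc_eq_integral_Ioo, ← intervalIntegral.integral_of_le (by norm_num)]
  rw [intervalIntegral.integral_eq_sub_of_hasDerivAt_of_le (by norm_num)
    (f := fun x => p.eval x * ((1 - x) ^ α * (1 + x) ^ β))]
  · simp [Real.zero_rpow hα.ne', Real.zero_rpow hβ.ne']
  · refine p.continuous.continuousOn.mul (ContinuousOn.mul ?_ ?_)
    · exact (continuous_const.sub continuous_id).continuousOn.rpow_const fun x _ => Or.inr hα.le
    · exact (continuous_const.add continuous_id).continuousOn.rpow_const fun x _ => Or.inr hβ.le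
  · intro x hx
    have h1 : (1 - x) ≠ 0 := by linarith [hx.2]
    have h2 : (1 + x) ≠ 0 := by linarith [hx.1]
    have d1 := ((hasDerivAt_id x).const_sub 1).rpow_const (p := α) (Or.inl h1)
    have d2 := ((hasDerivAt_id x).const_add 1).rpow_const (p := β) (Or.inl h2)
    refine ((p.hasDerivAt x).mul (d1.mul d2)).congr_deriv ?_
    simp only [id, Pi.mul_apply, Real.rpow_sub_one h1, Real.rpow_sub_one h2, eval_add,
      eval_mul, eval_sub, eval_pow, eval_X, eval_one, eval_C]
    field_simp
    ring
  · rw [intervalIntegrable_iff_integrableOn_Ioo_of_le (by norm_num)]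
    exact integrableOn_eval_mul_jacobiWeight hα hβ _

theorem integral_jacobiWeight_pos {α β : ℝ} (hα : 0 < α) (hβ : 0 < β) :
    0 < ∫ x in Set.Ioo (-1 : ℝ) 1, (1 : ℝ[X]).eval x * ((1 - x) ^ (α - 1) * (1 + x) ^ (β - 1)) := by
  rw [← integral_Ioc_eq_integral_Ioo, ← intervalIntegral.integral_of_le (by norm_num)]
  simp only [eval_one, one_mul]
  refine intervalIntegral.intervalIntegral_pos_of_pos_on
    (intervalIntegrable_jacobiWeight hα hβ) (fun x hx => ?_) (by norm_num)
  have h1 : 0 < 1 - x := by linarith [hx.2]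
  have h2 : 0 < 1 + x := by linarith [hx.1]
  positivity

theorem integral_jacobiWeight_mono {α β : ℝ} (hα : 0 < α) (hβ : 0 < β) {p q : ℝ[X]}
    (h : ∀ x ∈ Set.Ioo (-1 : ℝ) 1, p.eval x ≤ q.eval x) :
    ∫ x in Set.Ioo (-1 : ℝ) 1, p.eval x * ((1 - x) ^ (α - 1) * (1 + x) ^ (β - 1)) ≤
    ∫ x in Set.Ioo (-1 : ℝ) 1, q.eval x * ((1 - x) ^ (α - 1) * (1 + x) ^ (β - 1)) := by
  refine setIntegral_mono_on (integrableOn_eval_mul_jacobiWeight hα hβ p)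
    (integrableOn_eval_mul_jacobiWeight hα hβ q) measurableSet_Ioo fun x hx => ?_
  have h1 : 0 < 1 - x := by linarith [hx.2]
  have h2 : 0 < 1 + x := by linarith [hx.1]
  exact mul_le_mul_of_nonneg_right (h x hx) (by positivity)

/-- The diagonal recurrence coefficients of the monic Jacobi polynomials with parameters
`α - 1`, `β - 1`. -/
noncomputable def jacobiB (α β : ℝ) : ℕ → ℝ
  | 0 => (β - α) / (α + β)
  | k + 1 => (β - α) * (α + β - 2) / ((2 * k + α + β) * (2 * k + α + β + 2))

/-- The off-diagonal recurrence coefficients of the monic Jacobi polynomials with parameters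
`α - 1`, `β - 1`. -/
noncomputable def jacobiG (α β : ℝ) : ℕ → ℝ
  | 0 => 4 * α * β / ((α + β) ^ 2 * (α + β + 1))
  | k + 1 => 4 * (k + 2) * (k + 1 + α) * (k + 1 + β) * (k + α + β) /
      ((2 * k + α + β + 2) ^ 2 * (2 * k + α + β + 3) * (2 * k + α + β + 1))

/-- The monic Jacobi polynomials with parameters `α - 1`, `β - 1`. -/
noncomputable def jacobiQ (α β : ℝ) : ℕ → ℝ[X]
  | 0 => 1
  | 1 => X - C (jacobiB α β 0)
  | n + 2 => (X - C (jacobiB α β (n + 1))) * jacobiQ α β (n + 1) -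
      C (jacobiG α β n) * jacobiQ α β n

/-- The subleading coefficient of `jacobiQ α β (k + 1)`. -/
noncomputable def jacobiU (α β : ℝ) (k : ℕ) : ℝ := -(β - α) * (k + 1) / (2 * k + α + β)

section
variable {α β : ℝ}

theorem jacobiG_pos (hα : 0 < α) (hβ : 0 < β) (k : ℕ) : 0 < jacobiG α β k := by
  cases k <;> simp only [jacobiG] <;> positivity

theorem jacobiU_succ (hα : 0 < α) (hβ : 0 < β) (k : ℕ) :
    jacobiU α β (k + 1) = jacobiU α β k - jacobiB α β (k + 1) := by
  have h1 : 2 * (k : ℝ) + α + β ≠ 0 := by positivity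
  have h2 : 2 * (k : ℝ) + α + β + 2 ≠ 0 := by positivity
  have h3 : 2 * ((k : ℝ) + 1) + α + β ≠ 0 := by positivity
  simp only [jacobiU, jacobiB]
  push_cast
  field_simp
  ring

theorem jacobiU_succ' (hα : 0 < α) (hβ : 0 < β) (k : ℕ) :
    jacobiU α β (k + 1) = jacobiB α β (k + 1) * (2 * k + (α + β) + 1) - (β - α) - jacobiU α β k := by
  have h1 : 2 * (k : ℝ) + α + β ≠ 0 := by positivity
  have h2 : 2 * (k : ℝ) + α + β + 2 ≠ 0 := by positivity
  have h3 : 2 * ((k : ℝ) + 1) + α + β ≠ 0 := by positivity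
  simp only [jacobiU, jacobiB]
  push_cast
  field_simp
  ring

theorem jacobiU_mul (hα : 0 < α) (hβ : 0 < β) (k : ℕ) :
    (k + 1) * (-(β - α) - jacobiU α β k) = jacobiU α β k * (k + (α + β) - 1) := by
  have h1 : 2 * (k : ℝ) + α + β ≠ 0 := by positivity
  simp only [jacobiU]
  field_simp
  ring

theorem jacobiG_mul (hα : 0 < α) (hβ : 0 < β) (k : ℕ) :
    (2 * k + (α + β) + 1) * jacobiG α β k * (2 * k + (α + β) - 1) =
      (k + 1) * (k + (α + β) - 1) - jacobiU α β k * (-(β - α) - jacobiU α β k) := by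
  cases k with
  | zero =>
    have h1 : α + β ≠ 0 := by positivity
    have h2 : α + β + 1 ≠ 0 := by positivity
    simp only [jacobiU, jacobiG]
    push_cast
    field_simp
    ring
  | succ k =>
    have h1 : 2 * (k : ℝ) + α + β + 2 ≠ 0 := by positivity
    have h2 : 2 * (k : ℝ) + α + β + 3 ≠ 0 := by positivity
    have h3 : 2 * (k : ℝ) + α + β + 1 ≠ 0 := by positivity
    have h4 : 2 * ((k : ℝ) + 1) + α + β = 2 * (k : ℝ) + α + β + 2 := by ring
    simp only [jacobiU, jacobiG]
    push_cast
    rw [h4]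
    field_simp
    ring

theorem jacobiG_succ (hα : 0 < α) (hβ : 0 < β) (k : ℕ) :
    (2 * k + (α + β) + 3) * jacobiG α β (k + 1) = 1 + jacobiG α β k * (2 * k + (α + β) - 1) -
      jacobiB α β (k + 1) * (jacobiU α β k - jacobiU α β (k + 1)) := by
  have h := jacobiG_mul hα hβ k
  have h' := jacobiG_mul hα hβ (k + 1)
  have hk : 2 * (k : ℝ) + (α + β) + 1 ≠ 0 := by positivity
  have hb : jacobiB α β (k + 1) = jacobiU α β k - jacobiU α β (k + 1) := by
    rw [jacobiU_succ hα hβ]; ring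
  rw [hb]
  push_cast at h'
  refine mul_right_cancel₀ hk ?_
  have e : 1 * (2 * (k : ℝ) + (α + β) + 1)
      - (jacobiU α β k - jacobiU α β (k + 1)) ^ 2 * (2 * (k : ℝ) + (α + β) + 1) +
      ((k + 1) * (k + (α + β) - 1) - jacobiU α β k * (-(β - α) - jacobiU α β k)) =
      (k + 1 + 1) * (k + 1 + (α + β) - 1) -
        jacobiU α β (k + 1) * (-(β - α) - jacobiU α β (k + 1)) := by
    have h1 : 2 * (k : ℝ) + α + β ≠ 0 := by positivity
    have h2 : 2 * (k : ℝ) + α + β + 2 ≠ 0 := by positivity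
    have h4 : 2 * ((k : ℝ) + 1) + α + β = 2 * (k : ℝ) + α + β + 2 := by ring
    simp only [jacobiU]
    push_cast
    rw [h4]
    field_simp
    ring
  linear_combination h' - h - e

/-- The lowering and raising structure relations of the monic Jacobi polynomials. -/
theorem jacobiQ_structure (hα : 0 < α) (hβ : 0 < β) (k : ℕ) :
    (1 - X ^ 2) * derivative (jacobiQ α β (k + 1)) =
      (C (jacobiU α β k) - C ((k : ℝ) + 1) * X) * jacobiQ α β (k + 1) +
        C ((2 * k + (α + β) + 1) * jacobiG α β k) * jacobiQ α β k ∧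
    (1 - X ^ 2) * derivative (jacobiQ α β k) =
      (C (k + (α + β) - 1) * X + C (-(β - α) - jacobiU α β k)) * jacobiQ α β k -
        C (2 * k + (α + β) - 1) * jacobiQ α β (k + 1) := by
  induction k with
  | zero =>
    have hs : α + β ≠ 0 := by positivity
    have hb : jacobiU α β 0 = - jacobiB α β 0 := by simp [jacobiU, jacobiB]; ring
    have e1 : (α + β + 1) * jacobiG α β 0 = 1 - jacobiB α β 0 ^ 2 := by
      have h2 : α + β + 1 ≠ 0 := by positivity
      simp only [jacobiG, jacobiB]
      field_simp
      ring
    have e2 : -(β - α) + jacobiB α β 0 = - (α + β - 1) * jacobiB α β 0 := by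
      simp only [jacobiB]
      field_simp
      ring
    constructor
    · simp only [jacobiQ, hb, Nat.cast_zero, mul_zero, zero_add, e1]
      simp only [derivative_sub, derivative_X, derivative_C, C_sub, C_neg, C_pow, C_1]
      ring
    · simp only [jacobiQ, hb, Nat.cast_zero, mul_zero, zero_add, sub_neg_eq_add, e2]
      simp only [derivative_one, C_sub, C_neg, C_mul, C_1]
      ring
  | succ k ih =>
    obtain ⟨ih1, ih2⟩ := ih
    constructor
    · have e1 := congrArg C (jacobiU_succ hα hβ k)
      have e2 := congrArg C (jacobiU_succ' hα hβ k)
      have e3 := congrArg C (jacobiG_succ hα hβ k)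
      simp only [jacobiQ, derivative_sub, derivative_mul, derivative_X, derivative_C]
      simp only [C_sub, C_neg, C_mul, C_1, C_add, Nat.cast_add, Nat.cast_one, Polynomial.C_ofNat] at *
      linear_combination (X - C (jacobiB α β (k + 1))) * ih1 - C (jacobiG α β k) * ih2
       - e3 * jacobiQ α β (k + 1) - X * e1 * jacobiQ α β (k + 1)
       + C (jacobiG α β k) * e2 * jacobiQ α β k
    · have e1 := congrArg C (jacobiU_succ' hα hβ k)
      simp only [jacobiQ]
      simp only [C_sub, C_neg, C_mul, C_1, C_add, Nat.cast_add, Nat.cast_one, Polynomial.C_ofNat] at *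
      linear_combination ih1 + e1 * jacobiQ α β (k + 1)

/-- The differential equation of the monic Jacobi polynomials. -/
theorem jacobiQ_ode (hα : 0 < α) (hβ : 0 < β) (k : ℕ) :
    (1 - X ^ 2) * derivative (derivative (jacobiQ α β k)) +
      (C (β - α) - C (α + β) * X) * derivative (jacobiQ α β k) =
      - C (k * (k + (α + β) - 1)) * jacobiQ α β k := by
  cases k with
  | zero => simp [jacobiQ]
  | succ k =>
    obtain ⟨h1, h2⟩ := jacobiQ_structure hα hβ k
    have h0 : (1 - X ^ 2 : ℝ[X]) ≠ 0 := fun h => by simpa using congrArg (eval 0) h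
    refine mul_left_cancel₀ h0 ?_
    have h3 := congrArg derivative h1
    have e1 := congrArg C (jacobiU_mul hα hβ k)
    have e2 := congrArg C (jacobiG_mul hα hβ k)
    simp only [derivative_add, derivative_sub, derivative_mul, derivative_X, derivative_C,
      derivative_X_pow, derivative_one, Nat.cast_ofNat] at h3
    simp only [C_sub, C_neg, C_mul, C_1, C_add, Nat.cast_add, Nat.cast_one,
      Polynomial.C_ofNat] at *
    linear_combination (1 - X ^ 2) * h3 +
      (2 * C (k : ℝ) + (C α + C β) + 1) * C (jacobiG α β k) * h2 -
      ((C (k : ℝ) + (C α + C β) - 1) * X + (-(C β - C α) - C (jacobiU α β k))) * h1 +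
      X * jacobiQ α β (k + 1) * e1 - jacobiQ α β (k + 1) * e2
end

/-- A linear functional on polynomials satisfying the Pearson equation of the Jacobi weight with
parameters `α - 1`, `β - 1`. -/
def IsJacobiPearson (α β : ℝ) (L : ℝ[X] →ₗ[ℝ] ℝ) : Prop :=
  ∀ p, L ((1 - X ^ 2) * derivative p + (C (β - α) - C (α + β) * X) * p) = 0

theorem map_C_mul_polynomial (L : ℝ[X] →ₗ[ℝ] ℝ) (c : ℝ) (p : ℝ[X]) : L (C c * p) = c * L p := by
  rw [← smul_eq_C_mul, map_smul, smul_eq_mul]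

/-- The `k`-th eigenvalue of the Jacobi differential operator. -/
def jacobiEigenvalue (α β : ℝ) (k : ℕ) : ℝ := k * (k + (α + β) - 1)

theorem jacobiEigenvalue_succ_pos {α β : ℝ} (hα : 0 < α) (hβ : 0 < β) (k : ℕ) :
    0 < jacobiEigenvalue α β (k + 1) := by
  have : jacobiEigenvalue α β (k + 1) = (k + 1) * (k + (α + β)) := by
    simp only [jacobiEigenvalue]; push_cast; ring
  rw [this]
  positivity

theorem jacobiEigenvalue_ne {α β : ℝ} (hα : 0 < α) (hβ : 0 < β) {j k : ℕ} (h : j ≠ k) :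
    jacobiEigenvalue α β j ≠ jacobiEigenvalue α β k := by
  intro he
  have h1 : ((j : ℝ) - k) * (j + k + (α + β) - 1) = 0 := by
    simp only [jacobiEigenvalue] at he
    linear_combination he
  have h2 : (1 : ℝ) ≤ j + k := by
    have : 1 ≤ j + k := by omega
    exact_mod_cast this
  rcases mul_eq_zero.1 h1 with h3 | h3
  · exact h (by exact_mod_cast sub_eq_zero.1 h3)
  · linarith

section
variable {α β : ℝ} {L : ℝ[X] →ₗ[ℝ] ℝ}

theorem IsJacobiPearson.dirichlet_eq (hL : IsJacobiPearson α β L) (hα : 0 < α) (hβ : 0 < β)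
    (k : ℕ) (p : ℝ[X]) :
    L ((1 - X ^ 2) * derivative (jacobiQ α β k) * derivative p) =
      jacobiEigenvalue α β k * L (jacobiQ α β k * p) := by
  have h := hL (derivative (jacobiQ α β k) * p)
  rw [derivative_mul] at h
  have e : (1 - X ^ 2) * (derivative (derivative (jacobiQ α β k)) * p +
      derivative (jacobiQ α β k) * derivative p) +
      (C (β - α) - C (α + β) * X) * (derivative (jacobiQ α β k) * p) =
      (1 - X ^ 2) * derivative (jacobiQ α β k) * derivative p -
        C (jacobiEigenvalue α β k) * (jacobiQ α β k * p) := by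
    rw [jacobiEigenvalue]
    linear_combination p * jacobiQ_ode hα hβ k
  rw [e, map_sub, map_C_mul_polynomial] at h
  linarith

theorem IsJacobiPearson.orthogonal (hL : IsJacobiPearson α β L) (hα : 0 < α) (hβ : 0 < β)
    {j k : ℕ} (h : j ≠ k) : L (jacobiQ α β j * jacobiQ α β k) = 0 := by
  have h1 := hL.dirichlet_eq hα hβ j (jacobiQ α β k)
  have h2 := hL.dirichlet_eq hα hβ k (jacobiQ α β j)
  rw [mul_comm (jacobiQ α β k), mul_right_comm, h1] at h2
  by_contra h0
  exact jacobiEigenvalue_ne hα hβ h (mul_right_cancel₀ h0 h2)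

theorem X_mul_jacobiQ_zero (α β : ℝ) :
    X * jacobiQ α β 0 = jacobiQ α β 1 + C (jacobiB α β 0) * jacobiQ α β 0 := by
  simp [jacobiQ]

theorem X_mul_jacobiQ_succ (α β : ℝ) (k : ℕ) :
    X * jacobiQ α β (k + 1) = jacobiQ α β (k + 2) +
      C (jacobiB α β (k + 1)) * jacobiQ α β (k + 1) + C (jacobiG α β k) * jacobiQ α β k := by
  rw [jacobiQ]
  ring

theorem IsJacobiPearson.sq_succ (hL : IsJacobiPearson α β L) (hα : 0 < α) (hβ : 0 < β) (k : ℕ) :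
    L (jacobiQ α β (k + 1) * jacobiQ α β (k + 1)) =
      jacobiG α β k * L (jacobiQ α β k * jacobiQ α β k) := by
  have h1 : L (X * jacobiQ α β (k + 1) * jacobiQ α β k) =
      jacobiG α β k * L (jacobiQ α β k * jacobiQ α β k) := by
    rw [X_mul_jacobiQ_succ, add_mul, add_mul, map_add, map_add, mul_assoc, mul_assoc,
      map_C_mul_polynomial, map_C_mul_polynomial, hL.orthogonal hα hβ (by omega : k + 2 ≠ k),
      hL.orthogonal hα hβ (by omega : k + 1 ≠ k)]
    ring
  rw [← h1]
  have h2 : L (jacobiQ α β (k + 1) * (X * jacobiQ α β k)) =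
      L (jacobiQ α β (k + 1) * jacobiQ α β (k + 1)) := by
    cases k with
    | zero =>
      rw [X_mul_jacobiQ_zero, mul_add, map_add, mul_left_comm, map_C_mul_polynomial,
        hL.orthogonal hα hβ (by omega : 0 + 1 ≠ 0)]
      ring
    | succ k =>
      rw [X_mul_jacobiQ_succ, mul_add, mul_add, map_add, map_add, mul_left_comm,
        map_C_mul_polynomial, mul_left_comm (jacobiQ α β (k + 1 + 1)),
        map_C_mul_polynomial, hL.orthogonal hα hβ (by omega : k + 1 + 1 ≠ k + 1),
        hL.orthogonal hα hβ (by omega : k + 1 + 1 ≠ k)]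
      ring
  rw [← h2]
  congr 1
  ring

theorem IsJacobiPearson.X_mul_sq (hL : IsJacobiPearson α β L) (hα : 0 < α) (hβ : 0 < β) (k : ℕ) :
    L (X * jacobiQ α β k * jacobiQ α β k) =
      jacobiB α β k * L (jacobiQ α β k * jacobiQ α β k) := by
  cases k with
  | zero =>
    rw [X_mul_jacobiQ_zero, add_mul, map_add, mul_assoc, map_C_mul_polynomial,
      hL.orthogonal hα hβ (by omega : 1 ≠ 0), zero_add]
  | succ k =>
    rw [X_mul_jacobiQ_succ, add_mul, add_mul, map_add, map_add, mul_assoc, mul_assoc,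
      map_C_mul_polynomial, map_C_mul_polynomial,
      hL.orthogonal hα hβ (by omega : k + 2 ≠ k + 1),
      hL.orthogonal hα hβ (by omega : k ≠ k + 1)]
    ring

theorem IsJacobiPearson.sq_pos (hL : IsJacobiPearson α β L) (hα : 0 < α) (hβ : 0 < β)
    (h1 : 0 < L 1) (k : ℕ) : 0 < L (jacobiQ α β k * jacobiQ α β k) := by
  induction k with
  | zero => simpa [jacobiQ] using h1
  | succ k ih => rw [hL.sq_succ hα hβ]; exact mul_pos (jacobiG_pos hα hβ k) ih

/-- The partial sum up to index `m` of the Jacobi expansion with coefficients `y`. -/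
noncomputable def jacobiPartialSum (α β : ℝ) (m : ℕ) (y : ℕ → ℝ) : ℝ[X] :=
  ∑ k ∈ Finset.range (m + 1), C (y k) * jacobiQ α β k

theorem jacobiPartialSum_zero (α β : ℝ) (y : ℕ → ℝ) : jacobiPartialSum α β 0 y = C (y 0) := by
  simp [jacobiPartialSum, jacobiQ]

theorem jacobiPartialSum_succ (α β : ℝ) (m : ℕ) (y : ℕ → ℝ) :
    jacobiPartialSum α β (m + 1) y = jacobiPartialSum α β m y + C (y (m + 1)) * jacobiQ α β (m + 1) :=
  Finset.sum_range_succ _ _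

theorem jacobiPartialSum_congr {m : ℕ} {y z : ℕ → ℝ} (h : ∀ k ≤ m, y k = z k) :
    jacobiPartialSum α β m y = jacobiPartialSum α β m z :=
  Finset.sum_congr rfl fun k hk => by rw [h k (by simpa [Nat.lt_succ_iff] using hk)]

theorem jacobiQ_monic (α β : ℝ) (k : ℕ) :
    (jacobiQ α β k).Monic ∧ (jacobiQ α β k).natDegree = k := by
  induction k using Nat.strong_induction_on with
  | _ k ih =>
    match k with
    | 0 => simp [jacobiQ]
    | 1 => exact ⟨monic_X_sub_C _, natDegree_X_sub_C _⟩
    | k + 2 =>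
      obtain ⟨h1, h1'⟩ := ih (k + 1) (by omega)
      obtain ⟨h2, h2'⟩ := ih k (by omega)
      have hm := (monic_X_sub_C (jacobiB α β (k + 1))).mul h1
      have hd : ((X - C (jacobiB α β (k + 1))) * jacobiQ α β (k + 1)).natDegree = k + 2 := by
        rw [(monic_X_sub_C _).natDegree_mul h1, natDegree_X_sub_C, h1']
        omega
      have hlt : (C (jacobiG α β k) * jacobiQ α β k).natDegree <
          ((X - C (jacobiB α β (k + 1))) * jacobiQ α β (k + 1)).natDegree := by
        rw [hd]
        exact (natDegree_C_mul_le _ _).trans_lt (by omega)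
      rw [jacobiQ]
      exact ⟨hm.sub_of_left (degree_lt_degree hlt),
        by rw [natDegree_sub_eq_left_of_natDegree_lt hlt, hd]⟩

theorem exists_eq_jacobiPartialSum (α β : ℝ) (m : ℕ) (p : ℝ[X]) (hp : p.natDegree ≤ m) :
    ∃ y, p = jacobiPartialSum α β m y := by
  induction m generalizing p with
  | zero =>
    refine ⟨fun _ => p.coeff 0, ?_⟩
    rw [jacobiPartialSum_zero]
    exact eq_C_of_natDegree_le_zero hp
  | succ m ih =>
    obtain ⟨hm, hd⟩ := jacobiQ_monic α β (m + 1)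
    have hlt : (p - C (p.coeff (m + 1)) * jacobiQ α β (m + 1)).natDegree ≤ m := by
      refine natDegree_le_iff_coeff_eq_zero.2 fun N hN => ?_
      rw [coeff_sub, coeff_C_mul]
      rcases (Nat.succ_le_of_lt hN).eq_or_lt with h | h
      · have : (jacobiQ α β (m + 1)).coeff (m + 1) = 1 := by
          have := hm.coeff_natDegree
          rwa [hd] at this
        rw [← h, Nat.succ_eq_add_one, this]
        ring
      · rw [coeff_eq_zero_of_natDegree_lt (by omega),
          coeff_eq_zero_of_natDegree_lt (by omega : (jacobiQ α β (m + 1)).natDegree < N)]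
        ring
    obtain ⟨y, hy⟩ := ih _ hlt
    refine ⟨Function.update y (m + 1) (p.coeff (m + 1)), ?_⟩
    rw [jacobiPartialSum_succ, Function.update_self, jacobiPartialSum_congr (z := y), ← hy]
    · ring
    · exact fun k hk => Function.update_of_ne (by omega) _ _

theorem IsJacobiPearson.jacobiPartialSum_mul_of_lt (hL : IsJacobiPearson α β L) (hα : 0 < α) (hβ : 0 < β)
    {m j : ℕ} (h : m < j) (y : ℕ → ℝ) : L (jacobiPartialSum α β m y * jacobiQ α β j) = 0 := by
  rw [jacobiPartialSum, Finset.sum_mul, map_sum]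
  refine Finset.sum_eq_zero fun k hk => ?_
  have hk := Finset.mem_range.1 hk
  rw [mul_assoc, map_C_mul_polynomial, hL.orthogonal hα hβ (by omega), mul_zero]

theorem IsJacobiPearson.jacobiPartialSum_mul_self (hL : IsJacobiPearson α β L) (hα : 0 < α) (hβ : 0 < β)
    (m : ℕ) (y : ℕ → ℝ) : L (jacobiPartialSum α β m y * jacobiQ α β m) =
      y m * L (jacobiQ α β m * jacobiQ α β m) := by
  cases m with
  | zero => rw [jacobiPartialSum_zero, map_C_mul_polynomial]; simp [jacobiQ]
  | succ m =>
    rw [jacobiPartialSum_succ, add_mul, map_add, hL.jacobiPartialSum_mul_of_lt hα hβ (by omega), mul_assoc,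
      map_C_mul_polynomial, zero_add]

theorem IsJacobiPearson.X_mul_jacobiPartialSum_mul (hL : IsJacobiPearson α β L) (hα : 0 < α)
    (hβ : 0 < β) (m : ℕ) (y : ℕ → ℝ) : L (X * jacobiQ α β (m + 1) * jacobiPartialSum α β m y) =
      y m * L (jacobiQ α β (m + 1) * jacobiQ α β (m + 1)) := by
  rw [X_mul_jacobiQ_succ, mul_comm, mul_add, mul_add, map_add, map_add,
    mul_left_comm, mul_left_comm _ (C (jacobiG α β m)), map_C_mul_polynomial, map_C_mul_polynomial,
    hL.jacobiPartialSum_mul_of_lt hα hβ (by omega), hL.jacobiPartialSum_mul_of_lt hα hβ (by omega),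
    hL.jacobiPartialSum_mul_self hα hβ, hL.sq_succ hα hβ]
  ring

theorem IsJacobiPearson.le_sq_jacobiPartialSum (hL : IsJacobiPearson α β L) (hα : 0 < α) (hβ : 0 < β)
    (h1 : 0 < L 1) (m : ℕ) (y : ℕ → ℝ) :
    L (jacobiQ α β m * jacobiQ α β m) * y m ^ 2 ≤ L (jacobiPartialSum α β m y * jacobiPartialSum α β m y) := by
  have hrec : ∀ m, L (jacobiPartialSum α β (m + 1) y * jacobiPartialSum α β (m + 1) y) =
      L (jacobiPartialSum α β m y * jacobiPartialSum α β m y) +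
        L (jacobiQ α β (m + 1) * jacobiQ α β (m + 1)) * y (m + 1) ^ 2 := by
    intro m
    have e : jacobiPartialSum α β (m + 1) y * jacobiPartialSum α β (m + 1) y =
        jacobiPartialSum α β m y * jacobiPartialSum α β m y +
        C (2 * y (m + 1)) * (jacobiPartialSum α β m y * jacobiQ α β (m + 1)) +
        C (y (m + 1) ^ 2) * (jacobiQ α β (m + 1) * jacobiQ α β (m + 1)) := by
      rw [jacobiPartialSum_succ]
      simp only [C_mul, C_pow, Polynomial.C_ofNat]
      ring
    rw [e, map_add, map_add, map_C_mul_polynomial, map_C_mul_polynomial,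
      hL.jacobiPartialSum_mul_of_lt hα hβ (by omega)]
    ring
  have e : jacobiPartialSum α β 0 y * jacobiPartialSum α β 0 y = C (y 0 ^ 2) * 1 := by
    rw [jacobiPartialSum_zero, mul_one, ← C_mul, sq]
  have hnn : ∀ m, 0 ≤ L (jacobiPartialSum α β m y * jacobiPartialSum α β m y) := by
    intro m
    induction m with
    | zero =>
      rw [e, map_C_mul_polynomial]
      positivity
    | succ m ih =>
      rw [hrec]
      have := hL.sq_pos hα hβ h1 (m + 1)
      positivity
  cases m with
  | zero =>
    rw [e, map_C_mul_polynomial]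
    simp [jacobiQ, mul_comm]
  | succ m => rw [hrec]; linarith [hnn m]

/-- The quadratic form `∫ p² dc₀ - t ∫ p'² dc₁` of the coherent pair. -/
noncomputable def coherentForm (L : ℝ[X] →ₗ[ℝ] ℝ) (ξ ε t : ℝ) (p : ℝ[X]) : ℝ :=
  L (C ε * (X - C ξ) * p * p) - t * L ((1 - X ^ 2) * derivative p * derivative p)

theorem IsJacobiPearson.coherentForm_zero (hL : IsJacobiPearson α β L) (hα : 0 < α) (hβ : 0 < β)
    (ξ ε t : ℝ) (y : ℕ → ℝ) : coherentForm L ξ ε t (jacobiPartialSum α β 0 y) =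
      ε * (jacobiB α β 0 - ξ) * L (jacobiQ α β 0 * jacobiQ α β 0) * y 0 ^ 2 := by
  have h := hL.X_mul_sq hα hβ 0
  have e : C ε * (X - C ξ) * C (y 0) * C (y 0) = C (ε * y 0 ^ 2) *
      (X * jacobiQ α β 0 * jacobiQ α β 0) - C (ε * ξ * y 0 ^ 2) *
      (jacobiQ α β 0 * jacobiQ α β 0) := by
    simp only [jacobiQ, C_mul, C_pow]
    ring
  rw [coherentForm, jacobiPartialSum_zero, e, map_sub, map_C_mul_polynomial, map_C_mul_polynomial, h]
  simp
  ring

theorem IsJacobiPearson.coherentForm_succ (hL : IsJacobiPearson α β L) (hα : 0 < α) (hβ : 0 < β)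
    (ξ ε t : ℝ) (m : ℕ) (y : ℕ → ℝ) : coherentForm L ξ ε t (jacobiPartialSum α β (m + 1) y) =
      coherentForm L ξ ε t (jacobiPartialSum α β m y) +
        L (jacobiQ α β (m + 1) * jacobiQ α β (m + 1)) * (2 * ε * y m * y (m + 1) +
          (ε * (jacobiB α β (m + 1) - ξ) - t * jacobiEigenvalue α β (m + 1)) * y (m + 1) ^ 2) := by
  have h1 := hL.X_mul_sq hα hβ (m + 1)
  have h2 := hL.X_mul_jacobiPartialSum_mul hα hβ m y
  have h3 := hL.jacobiPartialSum_mul_of_lt hα hβ (by omega : m < m + 1) y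
  have h4 := hL.dirichlet_eq hα hβ (m + 1) (jacobiQ α β (m + 1))
  have h5 := hL.dirichlet_eq hα hβ (m + 1) (jacobiPartialSum α β m y)
  rw [mul_comm (jacobiQ α β (m + 1)), h3] at h5
  have e1 : C ε * (X - C ξ) * jacobiPartialSum α β (m + 1) y * jacobiPartialSum α β (m + 1) y =
      C ε * (X - C ξ) * jacobiPartialSum α β m y * jacobiPartialSum α β m y +
      C (2 * ε * y (m + 1)) * (X * jacobiQ α β (m + 1) * jacobiPartialSum α β m y) -
      C (2 * ε * ξ * y (m + 1)) * (jacobiPartialSum α β m y * jacobiQ α β (m + 1)) +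
      C (ε * y (m + 1) ^ 2) * (X * jacobiQ α β (m + 1) * jacobiQ α β (m + 1)) -
      C (ε * ξ * y (m + 1) ^ 2) * (jacobiQ α β (m + 1) * jacobiQ α β (m + 1)) := by
    rw [jacobiPartialSum_succ]
    simp only [C_mul, C_pow, Polynomial.C_ofNat]
    ring
  have e2 : (1 - X ^ 2) * derivative (jacobiPartialSum α β (m + 1) y) *
        derivative (jacobiPartialSum α β (m + 1) y) =
      (1 - X ^ 2) * derivative (jacobiPartialSum α β m y) * derivative (jacobiPartialSum α β m y) +
      C (2 * y (m + 1)) * ((1 - X ^ 2) * derivative (jacobiQ α β (m + 1)) *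
        derivative (jacobiPartialSum α β m y)) +
      C (y (m + 1) ^ 2) * ((1 - X ^ 2) * derivative (jacobiQ α β (m + 1)) *
        derivative (jacobiQ α β (m + 1))) := by
    rw [jacobiPartialSum_succ]
    simp only [C_mul, C_pow, Polynomial.C_ofNat, derivative_add, derivative_C_mul]
    ring
  simp only [coherentForm]
  rw [e1, e2]
  simp only [map_add, map_sub, map_C_mul_polynomial, h1, h2, h3, h4, h5]
  ring

/-- The pivots, divided by the squared norms of the Jacobi polynomials, of the Gaussian
elimination of `coherentForm`. -/
noncomputable def coherentPivot (α β ξ ε t : ℝ) : ℕ → ℝ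
  | 0 => ε * (jacobiB α β 0 - ξ)
  | k + 1 => ε * (jacobiB α β (k + 1) - ξ) - t * jacobiEigenvalue α β (k + 1) -
      jacobiG α β k / coherentPivot α β ξ ε t k

theorem IsJacobiPearson.pivot_le_coherentForm (hL : IsJacobiPearson α β L) (hα : 0 < α)
    (hβ : 0 < β) (h1 : 0 < L 1) {ξ ε t : ℝ} (hε : ε ^ 2 = 1) {m : ℕ}
    (hd : ∀ k < m, 0 < coherentPivot α β ξ ε t k) (y : ℕ → ℝ) :
    coherentPivot α β ξ ε t m * L (jacobiQ α β m * jacobiQ α β m) * y m ^ 2 ≤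
      coherentForm L ξ ε t (jacobiPartialSum α β m y) := by
  induction m with
  | zero => rw [hL.coherentForm_zero hα hβ]; rfl
  | succ m ih =>
    have ih := ih fun k hk => hd k (by omega)
    have hpos := hd m (by omega)
    have hq := hL.sq_pos hα hβ h1 m
    rw [hL.coherentForm_succ hα hβ, coherentPivot, hL.sq_succ hα hβ]
    set d := coherentPivot α β ξ ε t m
    set h := L (jacobiQ α β m * jacobiQ α β m)
    set g := jacobiG α β m
    have hsq : 0 ≤ h * d * (y m + ε * (g / d) * y (m + 1)) ^ 2 := by positivity
    have e : h * d * (y m + ε * (g / d) * y (m + 1)) ^ 2 = d * h * y m ^ 2 +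
        2 * ε * g * h * y m * y (m + 1) + ε ^ 2 * (g * h * (g / d) * y (m + 1) ^ 2) := by
      field_simp
      ring
    rw [e, hε] at hsq
    linarith

theorem IsJacobiPearson.exists_coherentForm_eq_pivot (hL : IsJacobiPearson α β L) (hα : 0 < α)
    (hβ : 0 < β) {ξ ε t : ℝ} (hε : ε ^ 2 = 1) {m : ℕ}
    (hd : ∀ k < m, 0 < coherentPivot α β ξ ε t k) (c : ℝ) :
    ∃ y : ℕ → ℝ, y m = c ∧ coherentForm L ξ ε t (jacobiPartialSum α β m y) =
      coherentPivot α β ξ ε t m * L (jacobiQ α β m * jacobiQ α β m) * c ^ 2 := by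
  induction m generalizing c with
  | zero => exact ⟨fun _ => c, rfl, by rw [hL.coherentForm_zero hα hβ]; rfl⟩
  | succ m ih =>
    have hpos := hd m (by omega)
    obtain ⟨y, hy, hF⟩ := ih (fun k hk => hd k (by omega))
      (-ε * (jacobiG α β m / coherentPivot α β ξ ε t m) * c)
    refine ⟨Function.update y (m + 1) c, Function.update_self .., ?_⟩
    rw [hL.coherentForm_succ hα hβ, coherentPivot, hL.sq_succ hα hβ, Function.update_self,
      Function.update_of_ne (by omega), jacobiPartialSum_congr (z := y)
        (fun k hk => Function.update_of_ne (by omega) _ _), hF, hy]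
    set d := coherentPivot α β ξ ε t m
    set h := L (jacobiQ α β m * jacobiQ α β m)
    set g := jacobiG α β m
    have e : d * h * (-ε * (g / d) * c) ^ 2 = ε ^ 2 * (g * h * (g / d) * c ^ 2) := by
      field_simp
    rw [e, hε]
    linear_combination (-2 * g * h * (g / d) * c ^ 2) * hε

/-- For `t ≤ 0` the form `coherentForm` is positive definite, hence so are all its pivots. -/
theorem IsJacobiPearson.coherentPivot_pos (hL : IsJacobiPearson α β L) (hα : 0 < α)
    (hβ : 0 < β) (h1 : 0 < L 1)
    (hmono : ∀ p q : ℝ[X], (∀ x ∈ Set.Ioo (-1 : ℝ) 1, p.eval x ≤ q.eval x) → L p ≤ L q)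
    {ξ ε t δ : ℝ} (hε : ε ^ 2 = 1) (hδ : 0 < δ)
    (hξ : ∀ x ∈ Set.Ioo (-1 : ℝ) 1, δ ≤ ε * (x - ξ)) (ht : t ≤ 0) (m : ℕ) :
    0 < coherentPivot α β ξ ε t m := by
  induction m using Nat.strong_induction_on with
  | _ m ih =>
    obtain ⟨y, hy, hF⟩ := hL.exists_coherentForm_eq_pivot hα hβ hε ih 1
    have hq := hL.sq_pos hα hβ h1 m
    have h2 := hL.le_sq_jacobiPartialSum hα hβ h1 m y
    rw [hy] at h2
    set p := jacobiPartialSum α β m y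
    have h3 : L (C δ * (p * p)) ≤ L (C ε * (X - C ξ) * p * p) := by
      refine hmono _ _ fun x hx => ?_
      simp only [eval_mul, eval_C, eval_sub, eval_X]
      nlinarith [mul_self_nonneg (p.eval x), hξ x hx]
    have h4 : L 0 ≤ L ((1 - X ^ 2) * derivative p * derivative p) := by
      refine hmono _ _ fun x hx => ?_
      simp only [eval_mul, eval_sub, eval_X, eval_pow, eval_one, eval_zero]
      have : 0 ≤ 1 - x ^ 2 := by nlinarith [hx.1, hx.2]
      rw [mul_assoc]
      exact mul_nonneg this (mul_self_nonneg _)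
    rw [map_C_mul_polynomial] at h3
    rw [map_zero] at h4
    have h5 : 0 < coherentForm L ξ ε t p := by
      rw [coherentForm]
      nlinarith [mul_nonneg (neg_nonneg.2 ht) h4, mul_pos hδ hq]
    rw [hF, one_pow, mul_one] at h5
    exact pos_of_mul_pos_left h5 hq.le
end

/-- The value of `A_k` at `t`, with the sign it has to the left of all its zeros removed. -/
noncomputable def signedA (α β ξ ε t : ℝ) (k : ℕ) : ℝ := (-1) ^ k * (ApolyJ α β ξ ε k).eval t

section
variable {α β ξ ε t : ℝ}

theorem CcoJ_succ_succ (hα : 0 < α) (hβ : 0 < β) (k : ℕ) :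
    CcoJ α β (k + 2) = jacobiG α β (k + 1) /
      (jacobiEigenvalue α β (k + 2) * jacobiEigenvalue α β (k + 1)) := by
  have e1 : jacobiEigenvalue α β (k + 2) = (k + 2) * (k + 1 + α + β) := by
    simp only [jacobiEigenvalue]; push_cast; ring
  have e2 : jacobiEigenvalue α β (k + 1) = (k + 1) * (k + α + β) := by
    simp only [jacobiEigenvalue]; push_cast; ring
  have f1 : ((k : ℝ) + 2) + α - 1 = k + 1 + α := by ring
  have f2 : ((k : ℝ) + 2) + β - 1 = k + 1 + β := by ring
  have f3 : ((k : ℝ) + 2) - 1 = k + 1 := by ring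
  have f4 : ((k : ℝ) + 2) + α + β - 1 = k + 1 + α + β := by ring
  have f5 : 2 * ((k : ℝ) + 2) + α + β - 1 = 2 * k + α + β + 3 := by ring
  have f6 : 2 * ((k : ℝ) + 2) + α + β - 2 = 2 * k + α + β + 2 := by ring
  have f7 : 2 * ((k : ℝ) + 2) + α + β - 3 = 2 * k + α + β + 1 := by ring
  rw [e1, e2, CcoJ, jacobiG]
  push_cast
  rw [f1, f2, f3, f4, f5, f6, f7]
  field_simp

theorem CcoJ_pos (hα : 0 < α) (hβ : 0 < β) (k : ℕ) : 0 < CcoJ α β (k + 2) := by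
  rw [CcoJ_succ_succ hα hβ]
  have h1 := jacobiG_pos hα hβ (k + 1)
  have h2 := jacobiEigenvalue_succ_pos hα hβ (k + 1)
  have h3 := jacobiEigenvalue_succ_pos hα hβ k
  positivity

theorem BcoJ_succ_succ (ξ ε : ℝ) (k : ℕ) :
    BcoJ α β ξ ε (k + 2) = -(ε * (jacobiB α β (k + 2) - ξ)) / jacobiEigenvalue α β (k + 2) := by
  have e1 : jacobiEigenvalue α β (k + 2) = (k + 2) * (k + 2 + α + β - 1) := by
    simp only [jacobiEigenvalue]; push_cast; ring
  have e2 : jacobiB α β (k + 2) = (β - α) * (α + β - 2) /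
      ((2 * ((k : ℝ) + 2) + α + β - 2) * (2 * ((k : ℝ) + 2) + α + β)) := by
    rw [jacobiB]; push_cast; congr 1; ring
  rw [e1, e2, BcoJ]
  push_cast
  ring

theorem signedA_succ_succ (α β ξ ε t : ℝ) (k : ℕ) :
    signedA α β ξ ε t (k + 2) = -(t + BcoJ α β ξ ε (k + 2)) * signedA α β ξ ε t (k + 1) -
      CcoJ α β (k + 2) * signedA α β ξ ε t k := by
  simp only [signedA, ApolyJ, eval_sub, eval_mul, eval_add, eval_X, eval_C, pow_succ]
  ring

theorem coherentPivot_one (hα : 0 < α) (hβ : 0 < β) (hε : ε ^ 2 = 1)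
    (h0 : coherentPivot α β ξ ε t 0 ≠ 0) :
    coherentPivot α β ξ ε t 1 = jacobiEigenvalue α β 1 * signedA α β ξ ε t 1 := by
  have hε0 : ε ≠ 0 := by rintro rfl; norm_num at hε
  have hs : α + β ≠ 0 := by positivity
  have h1 : 1 + α + β ≠ 0 := by positivity
  have h2 : 2 + α + β ≠ 0 := by positivity
  have h3 : α + β + 1 ≠ 0 := by positivity
  have h4 : α + β + 2 ≠ 0 := by positivity
  obtain ⟨D, rfl⟩ : ∃ D, ξ = (D + β - α) / (α + β) :=
    ⟨ξ * (α + β) - β + α, by field_simp; ring⟩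
  have e0 : (β - α) / (α + β) - (D + β - α) / (α + β) = -D / (α + β) := by ring
  have e1 : (D + β - α) / (α + β) * (α + β) - β + α = D := by field_simp; ring
  have e2 : jacobiEigenvalue α β 1 = α + β := by simp [jacobiEigenvalue]
  simp only [coherentPivot, jacobiB, e0] at h0
  have hD : D ≠ 0 := by rintro rfl; simp at h0
  have e3 : jacobiG α β 0 / (ε * (-D / (α + β))) =
      -ε * (4 * α * β / ((α + β) * (α + β + 1))) / D := by
    rw [jacobiG]
    field_simp
    linear_combination hε
  simp only [coherentPivot, signedA, ApolyJ, jacobiB, eval_add, eval_X, eval_C, e0, e1, e2, e3,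
    Nat.cast_zero, mul_zero, zero_add, pow_one]
  field_simp
  ring

theorem coherentPivot_mul_signedA (hα : 0 < α) (hβ : 0 < β) (hε : ε ^ 2 = 1)
    (h0 : coherentPivot α β ξ ε t 0 ≠ 0) {k : ℕ} (ha : ∀ j ≤ k, signedA α β ξ ε t j ≠ 0) :
    coherentPivot α β ξ ε t (k + 1) * signedA α β ξ ε t k =
      jacobiEigenvalue α β (k + 1) * signedA α β ξ ε t (k + 1) := by
  induction k with
  | zero =>
    rw [coherentPivot_one hα hβ hε h0]
    simp [signedA, ApolyJ]
  | succ k ih =>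
    have ih := ih fun j hj => ha j (by omega)
    have hak := ha k (by omega)
    have hak1 := ha (k + 1) le_rfl
    have l1 := (jacobiEigenvalue_succ_pos hα hβ k).ne'
    have l2 := (jacobiEigenvalue_succ_pos hα hβ (k + 1)).ne'
    have e : coherentPivot α β ξ ε t (k + 1) =
        jacobiEigenvalue α β (k + 1) * signedA α β ξ ε t (k + 1) / signedA α β ξ ε t k := by
      rw [eq_div_iff hak, ih]
    rw [signedA_succ_succ, coherentPivot, e, CcoJ_succ_succ hα hβ, BcoJ_succ_succ]
    field_simp
    ring

theorem coherentPivot_pos_of_signedA_pos (hα : 0 < α) (hβ : 0 < β) (hε : ε ^ 2 = 1)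
    (h0 : 0 < coherentPivot α β ξ ε t 0) {n : ℕ} (ha : ∀ j < n, 0 < signedA α β ξ ε t j) :
    ∀ k < n, 0 < coherentPivot α β ξ ε t k := by
  intro k hk
  cases k with
  | zero => exact h0
  | succ k =>
    have h := coherentPivot_mul_signedA hα hβ hε h0.ne'
      (fun j (hj : j ≤ k) => (ha j (by omega)).ne')
    exact pos_of_mul_pos_left (h ▸ mul_pos (jacobiEigenvalue_succ_pos hα hβ k) (ha _ hk))
      (ha k (by omega)).le

theorem signedA_pos_of_coherentPivot_pos (hα : 0 < α) (hβ : 0 < β) (hε : ε ^ 2 = 1)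
    (hd : ∀ k, 0 < coherentPivot α β ξ ε t k) (k : ℕ) : 0 < signedA α β ξ ε t k := by
  induction k using Nat.strong_induction_on with
  | _ k ih =>
    cases k with
    | zero => simp [signedA, ApolyJ]
    | succ k =>
      have h := coherentPivot_mul_signedA hα hβ hε (hd 0).ne'
        (fun j (hj : j ≤ k) => (ih j (by omega)).ne')
      exact pos_of_mul_pos_right (h ▸ mul_pos (hd (k + 1)) (ih k (by omega)))
        (jacobiEigenvalue_succ_pos hα hβ k).le

theorem signedA_eq_zero_iff {k : ℕ} :
    signedA α β ξ ε t k = 0 ↔ (ApolyJ α β ξ ε k).eval t = 0 := by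
  simp [signedA]

theorem continuous_signedA (α β ξ ε : ℝ) (k : ℕ) : Continuous fun t => signedA α β ξ ε t k :=
  continuous_const.mul (ApolyJ α β ξ ε k).continuous

theorem exists_signedA_eq_zero {k : ℕ} {r s : ℝ} (hrs : r ≤ s) (hr : 0 < signedA α β ξ ε r k)
    (hs : signedA α β ξ ε s k ≤ 0) : ∃ x ∈ Set.Icc r s, signedA α β ξ ε x k = 0 :=
  intermediate_value_Icc' hrs (continuous_signedA α β ξ ε k).continuousOn ⟨hs, hr.le⟩

/-- Interlacing of the smallest zeros. -/
theorem exists_isLeast_zero (hα : 0 < α) (hβ : 0 < β)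
    (hpos : ∀ s ≤ 0, ∀ k, 0 < signedA α β ξ ε s k) (n : ℕ) :
    ∃ μ, IsLeast {x : ℝ | (ApolyJ α β ξ ε (n + 1)).eval x = 0} μ ∧
      (∀ k ≤ n, 0 < signedA α β ξ ε μ k) ∧
      ∀ s < μ, ∀ k ≤ n + 1, 0 < signedA α β ξ ε s k := by
  induction n with
  | zero =>
    obtain ⟨c, hc⟩ : ∃ c, ApolyJ α β ξ ε (0 + 1) = X + C c := ⟨_, rfl⟩
    refine ⟨-c, ⟨by simp [hc], fun x hx => ?_⟩, fun k hk => ?_, fun s hs k hk => ?_⟩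
    · simp only [hc, Set.mem_ofPred_eq, eval_add, eval_X, eval_C] at hx
      linarith
    · obtain rfl : k = 0 := by omega
      simp [signedA, ApolyJ]
    · obtain rfl | rfl : k = 0 ∨ k = 0 + 1 := by omega
      · simp [signedA, ApolyJ]
      · simp only [signedA, hc, eval_add, eval_X, eval_C]
        rw [zero_add, pow_one]
        linarith
  | succ n ih =>
    obtain ⟨μ, hμ, hk, hlt⟩ := ih
    have hμ0 : 0 < μ := by
      by_contra! h
      exact (hpos μ h (n + 1)).ne' (signedA_eq_zero_iff.2 hμ.1)
    have hneg : signedA α β ξ ε μ (n + 2) < 0 := by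
      rw [signedA_succ_succ, signedA_eq_zero_iff.2 hμ.1]
      have := mul_pos (CcoJ_pos hα hβ n) (hk n le_rfl)
      linarith
    have hne : ApolyJ α β ξ ε (n + 1 + 1) ≠ 0 := by
      intro h
      have := hpos 0 le_rfl (n + 1 + 1)
      simp [signedA, h] at this
    obtain ⟨x, hx, hx0⟩ := exists_signedA_eq_zero hμ0.le (hpos 0 le_rfl _) hneg.le
    have hfin : {x : ℝ | (ApolyJ α β ξ ε (n + 1 + 1)).eval x = 0}.Finite := by
      refine (ApolyJ α β ξ ε (n + 1 + 1)).roots.toFinset.finite_toSet.subset fun z hz => ?_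
      simpa [hne] using hz
    obtain ⟨ν, hν, hmin⟩ := hfin.exists_minimalFor id _ ⟨x, signedA_eq_zero_iff.1 hx0⟩
    have hν : IsLeast {x : ℝ | (ApolyJ α β ξ ε (n + 1 + 1)).eval x = 0} ν :=
      ⟨hν, fun z hz => (le_total ν z).elim id fun h => hmin hz h⟩
    have hνμ : ν < μ := by
      refine ((hν.2 (signedA_eq_zero_iff.1 hx0)).trans hx.2).lt_of_ne fun h => hneg.ne ?_
      exact signedA_eq_zero_iff.2 (h ▸ hν.1)
    refine ⟨ν, hν, hlt ν hνμ, fun s hs k hkn => ?_⟩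
    rcases Nat.lt_or_ge k (n + 2) with h | h
    · exact hlt s (hs.trans hνμ) k (by omega)
    · obtain rfl : k = n + 1 + 1 := by omega
      by_contra! hle
      rcases le_total s 0 with h0 | h0
      · exact absurd (hpos s h0 (n + 1 + 1)) hle.not_gt
      · obtain ⟨z, hz, hz0⟩ := exists_signedA_eq_zero h0 (hpos 0 le_rfl _) hle
        exact absurd (hν.2 (signedA_eq_zero_iff.1 hz0)) (by linarith [hz.2] : ¬ ν ≤ z)
end

theorem stmt16 (α β ξ ε : ℝ) (hα : 0 < α) (hβ : 0 < β) (hξ : 1 < |ξ|)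
    (hε : ε = if ξ < -1 then 1 else -1) (n : ℕ) (hn : 1 ≤ n) :
    (∃ x : ℝ, (ApolyJ α β ξ ε n).eval x = 0) ∧
    (∀ x : ℝ, (ApolyJ α β ξ ε n).eval x = 0 → 0 < x) ∧
    ∀ μ : ℝ, IsLeast {x : ℝ | (ApolyJ α β ξ ε n).eval x = 0} μ →
      ∀ p : Polynomial ℝ, p.degree ≤ n →
        (∫ x in Set.Ioo (-1 : ℝ) 1,
            ((Polynomial.derivative p).eval x) ^ 2 * (1 - x) ^ α * (1 + x) ^ β) ≤
          (1 / μ) * ∫ x in Set.Ioo (-1 : ℝ) 1,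
            (p.eval x) ^ 2 * (ε * (x - ξ)) * (1 - x) ^ (α - 1) * (1 + x) ^ (β - 1) := by
  obtain ⟨L, hLi⟩ := exists_jacobiFunctional hα hβ
  have hL : IsJacobiPearson α β L := fun p => by
    rw [hLi]; exact integral_pearson_jacobiWeight hα hβ p
  have h1 : 0 < L 1 := by rw [hLi]; exact integral_jacobiWeight_pos hα hβ
  have hmono : ∀ p q : ℝ[X], (∀ x ∈ Set.Ioo (-1 : ℝ) 1, p.eval x ≤ q.eval x) → L p ≤ L q :=
    fun p q h => by rw [hLi, hLi]; exact integral_jacobiWeight_mono hα hβ h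
  have hε2 : ε ^ 2 = 1 := by rw [hε]; split_ifs <;> norm_num
  have hδ : 0 < |ξ| - 1 := by linarith
  have hbd : ∀ x ∈ Set.Ioo (-1 : ℝ) 1, |ξ| - 1 ≤ ε * (x - ξ) := by
    intro x hx
    rw [hε]
    split_ifs with h
    · rw [abs_of_neg (by linarith)]; linarith [hx.1]
    · rcases lt_abs.1 hξ with h' | h'
      · rw [abs_of_pos (by linarith)]; linarith [hx.2]
      · linarith
  have hpos : ∀ s ≤ 0, ∀ k, 0 < signedA α β ξ ε s k := fun s hs =>
    signedA_pos_of_coherentPivot_pos hα hβ hε2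
      (hL.coherentPivot_pos hα hβ h1 hmono hε2 hδ hbd hs)
  have hroot : ∀ x : ℝ, (ApolyJ α β ξ ε n).eval x = 0 → 0 < x := by
    intro x hx
    by_contra! h
    exact (hpos x h n).ne' (signedA_eq_zero_iff.2 hx)
  obtain ⟨m, rfl⟩ : ∃ m, n = m + 1 := ⟨n - 1, by omega⟩
  obtain ⟨ν, hν, hk, -⟩ := exists_isLeast_zero hα hβ hpos m
  refine ⟨⟨ν, hν.1⟩, hroot, fun μ hμ p hp => ?_⟩
  obtain rfl := hμ.unique hν
  have hμ0 := hroot μ hμ.1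
  have hd0 : 0 < coherentPivot α β ξ ε μ 0 :=
    hL.coherentPivot_pos hα hβ h1 hmono hε2 hδ hbd le_rfl 0
  have hd := coherentPivot_pos_of_signedA_pos hα hβ hε2 hd0
    (fun j (hj : j < m + 1) => hk j (by omega))
  have hlast : coherentPivot α β ξ ε μ (m + 1) = 0 := by
    have h := coherentPivot_mul_signedA hα hβ hε2 hd0.ne' fun j hj => (hk j hj).ne'
    rw [signedA_eq_zero_iff.2 hμ.1, mul_zero] at h
    exact (mul_eq_zero.1 h).resolve_right (hk m le_rfl).ne'
  obtain ⟨y, rfl⟩ := exists_eq_jacobiPartialSum α β (m + 1) p (natDegree_le_of_degree_le hp)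
  have hform := hL.pivot_le_coherentForm hα hβ h1 hε2 hd y
  rw [hlast, zero_mul, zero_mul, coherentForm, hLi, hLi] at hform
  set p := jacobiPartialSum α β (m + 1) y
  have i1 : ∫ x in Set.Ioo (-1 : ℝ) 1,
      ((Polynomial.derivative p).eval x) ^ 2 * (1 - x) ^ α * (1 + x) ^ β =
      ∫ x in Set.Ioo (-1 : ℝ) 1, ((1 - X ^ 2) * derivative p * derivative p).eval x *
        ((1 - x) ^ (α - 1) * (1 + x) ^ (β - 1)) := by
    refine setIntegral_congr_fun measurableSet_Ioo fun x hx => ?_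
    simp only [eval_mul, eval_sub, eval_one, eval_pow, eval_X]
    rw [mul_assoc, jacobiWeight_mul_one_sub_mul_one_add hx]
    ring
  have i2 : ∫ x in Set.Ioo (-1 : ℝ) 1,
      (p.eval x) ^ 2 * (ε * (x - ξ)) * (1 - x) ^ (α - 1) * (1 + x) ^ (β - 1) =
      ∫ x in Set.Ioo (-1 : ℝ) 1, (C ε * (X - C ξ) * p * p).eval x *
        ((1 - x) ^ (α - 1) * (1 + x) ^ (β - 1)) := by
    refine setIntegral_congr_fun measurableSet_Ioo fun x _ => ?_
    simp only [eval_mul, eval_sub, eval_C, eval_X]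
    ring
  rw [i1, i2, one_div, inv_mul_eq_div, le_div_iff₀ hμ0]
  linarith
end

section
/- Let γ > 0, let ε ∈ {1, -1}, and let P_j^{(γ-1)} denote the monic Jacobi polynomial P_j^{(0,γ-1)} if ε = 1 and P_j^{(γ-1,0)} if ε = -1. Then for all natural numbers i ≥ j, ∫_{-1}^1 (1-εx)^i·P_j^{(γ-1)}(x)·(1+εx)^{γ-1} dx = (-ε)^j · 2^{i+j+γ} · i! · j! · (Γ(j+γ)/Γ(2j+γ)) · C(i,j) / (γ+j)_{i+1}, where (a)_k = a(a+1)⋯(a+k-1) is the Pochhammer symbol and C(i,j) the binomial coefficient. -/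
open Polynomial MeasureTheory

/-- The monic Jacobi polynomial `P_n^{(α,β)}`. -/
noncomputable def jacobiP (α β : ℝ) (n : ℕ) : Polynomial ℝ :=
  ∑ m ∈ Finset.range (n + 1),
    Polynomial.C ((2 : ℝ) ^ n * (Real.Gamma (α + n + 1) / Real.Gamma (α + β + 2 * n + 1)) *
      (n.choose m) * (Real.Gamma (α + β + n + m + 1) / Real.Gamma (α + m + 1)) *
      ((1 : ℝ) / 2) ^ m) * (Polynomial.X - 1) ^ m

open Finset in
/-- The Chu–Vandermonde summation in Gamma-function form. -/
theorem sum_choose_mul_Gamma_div_Gamma (n : ℕ) {p q : ℝ} (hp : 0 < p) (hq : 0 < q) :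
    ∑ m ∈ range (n + 1), (-1 : ℝ) ^ m * n.choose m * (Real.Gamma (p + m) / Real.Gamma (q + m)) =
      Real.Gamma p / Real.Gamma (q + n) * (ascPochhammer ℝ n).eval (q - p) := by
  induction n generalizing p q with
  | zero => simp
  | succ n ih =>
    have hsplit : ∑ m ∈ range (n + 1 + 1),
        (-1 : ℝ) ^ m * (n + 1).choose m * (Real.Gamma (p + m) / Real.Gamma (q + m)) =
        ∑ m ∈ range (n + 1),
          (-1 : ℝ) ^ m * n.choose m * (Real.Gamma (p + m) / Real.Gamma (q + m)) -
        ∑ m ∈ range (n + 1),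
          (-1 : ℝ) ^ m * n.choose m * (Real.Gamma (p + 1 + m) / Real.Gamma (q + 1 + m)) := by
      have hext : ∑ m ∈ range (n + 1),
          (-1 : ℝ) ^ m * n.choose m * (Real.Gamma (p + m) / Real.Gamma (q + m)) =
          ∑ m ∈ range (n + 1 + 1),
          (-1 : ℝ) ^ m * n.choose m * (Real.Gamma (p + m) / Real.Gamma (q + m)) := by
        rw [sum_range_succ _ (n + 1)]
        simp
      rw [hext, sum_range_succ', sum_range_succ' _ (n + 1), add_sub_right_comm,
        ← sum_sub_distrib]
      congr 1
      · refine sum_congr rfl fun m _ => ?_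
        rw [Nat.choose_succ_succ]
        push_cast
        rw [show p + 1 + (m : ℝ) = p + (m + 1) by ring, show q + 1 + (m : ℝ) = q + (m + 1) by ring]
        ring
      · simp
    have hqn : 0 < q + n := by positivity
    rw [hsplit, ih hp hq, ih (by linarith) (by linarith), ascPochhammer_succ_eval,
      Real.Gamma_add_one hp.ne', show q + 1 + (n : ℝ) = q + n + 1 by ring,
      show q + ((n + 1 : ℕ) : ℝ) = q + n + 1 by push_cast; ring, Real.Gamma_add_one hqn.ne']
    have h := (Real.Gamma_pos_of_pos hqn).ne'
    rw [show q + 1 - (p + 1) = q - p by ring]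
    field_simp
    ring

open Finset in
/-- A case of the Pfaff–Saalschütz summation in Gamma-function form. -/
theorem sum_choose_mul_Gamma_saalschutz (i n : ℕ) {b : ℝ} (hb : (n : ℝ) < b) :
    ∑ m ∈ range (n + 1), (-1 : ℝ) ^ m * n.choose m * (Real.Gamma (b + m) *
      ((i + m).factorial / m.factorial) / Real.Gamma (b - n + i + 1 + m)) =
      (-1) ^ n * i.factorial * i.choose n * Real.Gamma b ^ 2 /
        (Real.Gamma (b - n) * Real.Gamma (b + i + 1)) := by
  induction n with
  | zero =>
    have hb' : 0 < b := by simpa using hb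
    have h := (Real.Gamma_pos_of_pos hb').ne'
    simp
    field_simp
  | succ n ih =>
    push_cast at hb
    have hn : (0 : ℝ) ≤ n := n.cast_nonneg
    have hi : (0 : ℝ) ≤ i := i.cast_nonneg
    specialize ih (by linarith)
    set u : ℕ → ℕ → ℝ := fun n m => (-1 : ℝ) ^ m * n.choose m * (Real.Gamma (b + m) *
      ((i + m).factorial / m.factorial) / Real.Gamma (b - n + i + 1 + m)) with hu
    have hu0 : u n (n + 1) = 0 := by simp [hu]
    have hstep0 : (n + 1 : ℝ) * u (n + 1) 0 =
        (i + 1) * b * u n 0 - (n - i) * (n + 1 - b) * u n 0 := by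
      have hd : 0 < b - (n + 1) + i + 1 := by linarith
      have h := (Real.Gamma_pos_of_pos hd).ne'
      simp only [hu]
      push_cast
      rw [show b - (n : ℝ) + i + 1 + 0 = b - (n + 1) + i + 1 + 1 by ring,
        Real.Gamma_add_one hd.ne', add_zero (b - ((n : ℝ) + 1) + i + 1)]
      simp
      have hd' : b - (n + 1) + i + 1 ≠ 0 := hd.ne'
      field_simp
      ring
    have hstep : ∀ m, (n + 1 : ℝ) * u (n + 1) (m + 1) + (n - i) * (n + 1 - b) * u n (m + 1) =
        (i + 1 + (m + 1 : ℕ)) * (b + (m + 1 : ℕ)) * u n (m + 1) -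
        (i + 1 + m) * (b + m) * u n m := by
      intro m
      have hm : (0 : ℝ) ≤ m := m.cast_nonneg
      have hd : 0 < b - n + i + 1 + m := by linarith
      have hbm : 0 < b + m := by linarith
      have h := (Real.Gamma_pos_of_pos hd).ne'
      have hc : ((n.choose (m + 1) : ℕ) : ℝ) * (m + 1) = n.choose m * (n - m) := by
        rcases le_or_gt m n with h | h
        · have := Nat.choose_succ_right_eq n m
          rw [← Nat.cast_sub h]
          exact_mod_cast this
        · simp [Nat.choose_eq_zero_of_lt h, Nat.choose_eq_zero_of_lt (Nat.lt_succ_of_lt h)]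
      simp only [hu]
      rw [Nat.choose_succ_succ, ← add_assoc i m 1, Nat.factorial_succ, Nat.factorial_succ]
      push_cast
      rw [show b - ((n : ℝ) + 1) + i + 1 + (m + 1) = b - n + i + 1 + m by ring,
        show b - (n : ℝ) + i + 1 + (m + 1) = b - n + i + 1 + m + 1 by ring,
        ← add_assoc b (m : ℝ) 1, Real.Gamma_add_one hd.ne', Real.Gamma_add_one hbm.ne']
      have hc' : (n.choose (m + 1) : ℝ) = n.choose m * (n - m) / (m + 1) := by
        field_simp
        exact hc
      rw [hc', pow_succ]
      have hmf : (m.factorial : ℝ) ≠ 0 := by positivity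
      have hd' := hd.ne'
      field_simp
      ring
    have hrec : (n + 1 : ℝ) * ∑ m ∈ range (n + 1 + 1), u (n + 1) m =
        -((n - i) * (n + 1 - b)) * ∑ m ∈ range (n + 1), u n m := by
      have hext : ∑ m ∈ range (n + 1), u n m = ∑ m ∈ range (n + 1 + 1), u n m := by
        rw [sum_range_succ _ (n + 1), hu0, add_zero]
      have htel := sum_range_sub (fun m : ℕ => (i + 1 + m : ℝ) * (b + m) * u n m) (n + 1)
      simp only [hu0, ← hstep, sum_add_distrib, ← mul_sum] at htel
      rw [hext, sum_range_succ', sum_range_succ' (u n)]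
      simp only [Nat.cast_zero, add_zero] at htel
      linear_combination htel + hstep0
    have hn1 : (n + 1 : ℝ) ≠ 0 := by positivity
    have hbn : 0 < b - (n + 1) := by linarith
    have h1 := (Real.Gamma_pos_of_pos hbn).ne'
    have h2 := (Real.Gamma_pos_of_pos (show 0 < b + i + 1 by linarith)).ne'
    have hc : ((i.choose (n + 1) : ℕ) : ℝ) * (n + 1) = i.choose n * (i - n) := by
      rcases le_or_gt n i with h | h
      · have := Nat.choose_succ_right_eq i n
        rw [← Nat.cast_sub h]
        exact_mod_cast this
      · simp [Nat.choose_eq_zero_of_lt h, Nat.choose_eq_zero_of_lt (Nat.lt_succ_of_lt h)]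
    change ∑ m ∈ range (n + 1 + 1), u (n + 1) m = _
    change ∑ m ∈ range (n + 1), u n m = _ at ih
    apply mul_left_cancel₀ hn1
    rw [hrec, ih, show b - (n : ℝ) = b - (n + 1) + 1 by ring, Real.Gamma_add_one hbn.ne']
    push_cast
    have hbn' := hbn.ne'
    rw [show ((i.choose (n + 1) : ℕ) : ℝ) = i.choose n * (i - n) / (n + 1) by
      field_simp
      exact hc, pow_succ]
    field_simp
    ring

theorem Gamma_mul_ascPochhammer_eval (n : ℕ) {x : ℝ} (hx : 0 < x) :
    Real.Gamma x * (ascPochhammer ℝ n).eval x = Real.Gamma (x + n) := by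
  induction n with
  | zero => simp
  | succ n ih =>
    have hxn : x + n ≠ 0 := by positivity
    rw [ascPochhammer_succ_eval, ← mul_assoc, ih, Nat.cast_succ, ← add_assoc,
      Real.Gamma_add_one hxn, mul_comm]

theorem intervalIntegral_rpow_mul_rpow_one_sub {p q : ℝ} (hp : 0 < p) (hq : 0 < q) :
    ∫ x in (0 : ℝ)..1, x ^ (p - 1) * (1 - x) ^ (q - 1) =
      Real.Gamma p * Real.Gamma q / Real.Gamma (p + q) := by
  have h := ProbabilityTheory.beta_eq_betaIntegralReal p q hp hq
  rw [ProbabilityTheory.beta] at h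
  rw [h, Complex.betaIntegral, ← Complex.ofReal_re (∫ x in (0 : ℝ)..1, _),
    ← intervalIntegral.integral_ofReal]
  congr 1
  refine intervalIntegral.integral_congr fun x hx => ?_
  rw [Set.uIcc_of_le zero_le_one] at hx
  have h1 : 0 ≤ 1 - x := by linarith [hx.2]
  push_cast [Complex.ofReal_cpow hx.1, Complex.ofReal_cpow h1]
  rfl

theorem integral_one_sub_rpow_mul_one_add_rpow {p q : ℝ} (hp : 0 < p) (hq : 0 < q) :
    ∫ x in Set.Ioo (-1 : ℝ) 1, (1 - x) ^ (p - 1) * (1 + x) ^ (q - 1) =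
      2 ^ (p + q - 1) * (Real.Gamma p * Real.Gamma q / Real.Gamma (p + q)) := by
  rw [← integral_Ioc_eq_integral_Ioo, ← intervalIntegral.integral_of_le (by norm_num)]
  have hsub := intervalIntegral.smul_integral_comp_sub_mul (a := 0) (b := 1)
    (fun x : ℝ => (1 - x) ^ (p - 1) * (1 + x) ^ (q - 1)) 2 1
  norm_num at hsub
  rw [← hsub, ← intervalIntegral_rpow_mul_rpow_one_sub hp hq,
    ← intervalIntegral.integral_const_mul, ← intervalIntegral.integral_const_mul]
  refine intervalIntegral.integral_congr fun x hx => ?_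
  rw [Set.uIcc_of_le zero_le_one] at hx
  have h1 : 0 ≤ 1 - x := by linarith [hx.2]
  rw [show 1 + (1 - 2 * x) = 2 * (1 - x) by ring, Real.mul_rpow zero_le_two hx.1,
    Real.mul_rpow zero_le_two h1, show p + q - 1 = 1 + (p - 1) + (q - 1) by ring,
    Real.rpow_add zero_lt_two, Real.rpow_add zero_lt_two, Real.rpow_one]
  ring

theorem integrableOn_one_sub_rpow_mul_one_add_rpow {p q : ℝ} (hp : 0 < p) (hq : 0 < q) :
    IntegrableOn (fun x : ℝ => (1 - x) ^ (p - 1) * (1 + x) ^ (q - 1)) (Set.Ioo (-1) 1) := by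
  refine not_imp_comm.mp integral_undef ?_
  rw [integral_one_sub_rpow_mul_one_add_rpow hp hq]
  have h1 := Real.Gamma_pos_of_pos hp
  have h2 := Real.Gamma_pos_of_pos hq
  have h3 := Real.Gamma_pos_of_pos (add_pos hp hq)
  positivity

theorem integral_jacobiP (α β : ℝ) (n : ℕ) {p q : ℝ} (hp : 0 < p) (hq : 0 < q) :
    ∫ x in Set.Ioo (-1 : ℝ) 1,
        (1 - x) ^ (p - 1) * (jacobiP α β n).eval x * (1 + x) ^ (q - 1) =
      2 ^ (p + q - 1 + n) * Real.Gamma q *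
        (Real.Gamma (α + n + 1) / Real.Gamma (α + β + 2 * n + 1)) *
        ∑ m ∈ Finset.range (n + 1), (-1 : ℝ) ^ m * n.choose m *
          (Real.Gamma (α + β + n + m + 1) / Real.Gamma (α + m + 1) *
            (Real.Gamma (p + m) / Real.Gamma (p + q + m))) := by
  set c : ℕ → ℝ := fun m =>
    (2 : ℝ) ^ n * (Real.Gamma (α + n + 1) / Real.Gamma (α + β + 2 * n + 1)) *
      (n.choose m) * (Real.Gamma (α + β + n + m + 1) / Real.Gamma (α + m + 1)) *
      ((1 : ℝ) / 2) ^ m with hc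
  have hpm (m : ℕ) : 0 < p + m := by positivity
  calc
    _ = ∫ x in Set.Ioo (-1 : ℝ) 1, ∑ m ∈ Finset.range (n + 1),
          c m * (-1) ^ m * ((1 - x) ^ (p + m - 1) * (1 + x) ^ (q - 1)) := by
      refine setIntegral_congr_fun measurableSet_Ioo fun x hx => ?_
      have hx1 : 0 < 1 - x := by linarith [hx.2]
      simp only [jacobiP, eval_finsetSum, Finset.mul_sum, Finset.sum_mul]
      refine Finset.sum_congr rfl fun m _ => ?_
      rw [show p + (m : ℝ) - 1 = p - 1 + m by ring, Real.rpow_add hx1, Real.rpow_natCast]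
      have hneg : (x - 1) ^ m = (-1) ^ m * (1 - x) ^ m := by
        rw [← mul_pow]
        ring
      simp only [eval_mul, eval_C, eval_pow, eval_sub, eval_X, eval_one, hneg, hc]
      ring
    _ = _ := by
      rw [integral_finsetSum _ fun m _ =>
        (integrableOn_one_sub_rpow_mul_one_add_rpow (hpm m) hq).const_mul _, Finset.mul_sum]
      refine Finset.sum_congr rfl fun m _ => ?_
      rw [integral_const_mul, integral_one_sub_rpow_mul_one_add_rpow (hpm m) hq,
        show p + m + q - 1 = p + q - 1 + (m : ℝ) by ring, Real.rpow_add zero_lt_two,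
        Real.rpow_add zero_lt_two, Real.rpow_natCast, Real.rpow_natCast,
        show p + m + q = p + q + (m : ℝ) by ring]
      simp only [hc, one_div, inv_pow]
      field_simp

theorem stmt18 (γ ε : ℝ) (hγ : 0 < γ) (i j : ℕ) (hij : j ≤ i) (P : Polynomial ℝ)
    (hP : (ε = 1 ∧ P = jacobiP 0 (γ - 1) j) ∨ (ε = -1 ∧ P = jacobiP (γ - 1) 0 j)) :
    ∫ x in Set.Ioo (-1 : ℝ) 1,
        (1 - ε * x) ^ i * P.eval x * (1 + ε * x) ^ (γ - 1) =
      (-ε) ^ j * (2 : ℝ) ^ ((i : ℝ) + (j : ℝ) + γ) * (i.factorial : ℝ) * (j.factorial : ℝ) *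
        (Real.Gamma ((j : ℝ) + γ) / Real.Gamma (2 * (j : ℝ) + γ)) * (i.choose j : ℝ) /
        (ascPochhammer ℝ (i + 1)).eval (γ + j) := by
  have hjγ : 0 < γ + j := by positivity
  have hG1 := (Real.Gamma_pos_of_pos hjγ).ne'
  have hG2 := (Real.Gamma_pos_of_pos (show 0 < 2 * (j : ℝ) + γ by positivity)).ne'
  have hG3 := (Real.Gamma_pos_of_pos hγ).ne'
  have hG4 := (Real.Gamma_pos_of_pos (show 0 < γ + j + i + 1 by positivity)).ne'
  have hpoch : (ascPochhammer ℝ (i + 1)).eval (γ + j) =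
      Real.Gamma (γ + j + i + 1) / Real.Gamma (γ + j) := by
    rw [eq_div_iff hG1, mul_comm, Gamma_mul_ascPochhammer_eval _ hjγ]
    push_cast
    ring_nf
  have hi : (0 : ℝ) < i + 1 := by positivity
  rw [hpoch]
  rcases hP with ⟨rfl, rfl⟩ | ⟨rfl, rfl⟩
  · have hint := integral_jacobiP 0 (γ - 1) j hi hγ
    have hsum := sum_choose_mul_Gamma_saalschutz i j (b := γ + j) (by linarith)
    simp only [add_sub_cancel_right, Real.rpow_natCast] at hint hsum
    simp only [one_mul]
    rw [hint]
    have hterms : ∑ m ∈ Finset.range (j + 1), (-1 : ℝ) ^ m * j.choose m *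
          (Real.Gamma (0 + (γ - 1) + j + m + 1) / Real.Gamma (0 + m + 1) *
            (Real.Gamma (i + 1 + m) / Real.Gamma (i + 1 + γ + m))) =
        ∑ m ∈ Finset.range (j + 1), (-1 : ℝ) ^ m * j.choose m * (Real.Gamma (γ + j + m) *
          ((i + m).factorial / m.factorial) / Real.Gamma (γ + i + 1 + m)) := by
      refine Finset.sum_congr rfl fun m _ => ?_
      rw [show 0 + (γ - 1) + j + m + 1 = γ + j + (m : ℝ) by ring, zero_add,
        Real.Gamma_nat_eq_factorial, show (i : ℝ) + 1 + m = ((i + m : ℕ) : ℝ) + 1 by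
          push_cast; ring, Real.Gamma_nat_eq_factorial,
        show (i : ℝ) + 1 + γ + m = γ + i + 1 + m by ring]
      ring
    rw [hterms, hsum, zero_add, Real.Gamma_nat_eq_factorial,
      show 0 + (γ - 1) + 2 * (j : ℝ) + 1 = 2 * j + γ by ring,
      show (i : ℝ) + 1 + γ - 1 + j = i + j + γ by ring, add_comm (j : ℝ) γ]
    field_simp
  · have hint := integral_jacobiP (γ - 1) 0 j hγ hi
    have hsum := sum_choose_mul_Gamma_div_Gamma j (p := γ + j) (q := γ + i + 1) hjγ
      (by positivity)
    have hfact : (ascPochhammer ℝ j).eval (γ + i + 1 - (γ + j)) =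
        j.factorial * i.choose j := by
      have h := Gamma_mul_ascPochhammer_eval j (x := ((i - j : ℕ) : ℝ) + 1) (by positivity)
      rw [show ((i - j : ℕ) : ℝ) + 1 + j = i + 1 by push_cast [Nat.cast_sub hij]; ring,
        Real.Gamma_nat_eq_factorial, Real.Gamma_nat_eq_factorial,
        ← Nat.choose_mul_factorial_mul_factorial hij] at h
      push_cast at h
      rw [show γ + i + 1 - (γ + j) = ((i - j : ℕ) : ℝ) + 1 by push_cast [Nat.cast_sub hij]; ring]
      have hf : ((i - j).factorial : ℝ) ≠ 0 := by positivity
      apply mul_left_cancel₀ hf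
      linear_combination h
    rw [hfact] at hsum
    simp only [add_sub_cancel_right, Real.rpow_natCast] at hint
    have hflip : ∀ x : ℝ, (1 - -1 * x) ^ i * (jacobiP (γ - 1) 0 j).eval x *
        (1 + -1 * x) ^ (γ - 1) =
        (1 - x) ^ (γ - 1) * (jacobiP (γ - 1) 0 j).eval x * (1 + x) ^ i := by
      intro x
      rw [show 1 - -1 * x = 1 + x by ring, show 1 + -1 * x = 1 - x by ring]
      ring
    simp only [hflip]
    rw [hint]
    have hterms : ∑ m ∈ Finset.range (j + 1), (-1 : ℝ) ^ m * j.choose m *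
          (Real.Gamma (γ - 1 + 0 + j + m + 1) / Real.Gamma (γ - 1 + m + 1) *
            (Real.Gamma (γ + m) / Real.Gamma (γ + (i + 1) + m))) =
        ∑ m ∈ Finset.range (j + 1), (-1 : ℝ) ^ m * j.choose m *
          (Real.Gamma (γ + j + m) / Real.Gamma (γ + i + 1 + m)) := by
      refine Finset.sum_congr rfl fun m _ => ?_
      have h := (Real.Gamma_pos_of_pos (show 0 < γ + m by positivity)).ne'
      rw [show γ - 1 + 0 + j + m + 1 = γ + j + (m : ℝ) by ring,
        show γ - 1 + m + 1 = γ + (m : ℝ) by ring, ← add_assoc γ (i : ℝ) 1]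
      field_simp
    rw [hterms, hsum, Real.Gamma_nat_eq_factorial,
      show γ - 1 + j + 1 = γ + (j : ℝ) by ring,
      show γ - 1 + 0 + 2 * (j : ℝ) + 1 = 2 * j + γ by ring,
      show γ + ((i : ℝ) + 1) - 1 + j = i + j + γ by ring, add_comm (j : ℝ) γ,
      show γ + i + 1 + (j : ℝ) = γ + j + i + 1 by ring]
    simp only [neg_neg, one_pow]
    field_simp
end
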